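/- arXiv:1109.1884 — 2 statements merged into one kernel-verified Lean document; each statement's English description precedes it below -/
import Mathlib

section
/- Let I ⊆ K[x_0, x_1, x_2] be the radical ideal of n ≥ 5 distinct points lying on a smooth conic C in P^2, where n is odd. Then I^{(mr)} = (I^{(m)})^r for every even integer m ≥ 2 and every integer r ≥ 1. -/
open MvPolynomial

noncomputable section

/-- The ideal generated by all homogeneous forms vanishing at the point with
coordinate vector `p`. -/
def homVanishingIdeal {K σ : Type*} [Field K] (p : σ → K) : Ideal (MvPolynomial σ K) :=
  Ideal.span {F : MvPolynomial σ K | (∃ d, F.IsHomogeneous d) ∧ MvPolynomial.eval p F = 0}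

/-- The `m`-th symbolic power of the radical ideal of the finite set of points
with coordinate vectors `P i`: the intersection of the `m`-th powers of the
ideals of the individual points. -/
def symbPow {K σ ι : Type*} [Field K] (P : ι → σ → K) (m : ℕ) : Ideal (MvPolynomial σ K) :=
  ⨅ i, homVanishingIdeal (P i) ^ m

/-- The irrelevant maximal ideal `M = (x_0, …, x_N)`. -/
def irrel (K σ : Type*) [Field K] : Ideal (MvPolynomial σ K) :=
  Ideal.span (Set.range (MvPolynomial.X : σ → MvPolynomial σ K))

/-- The coordinate vectors `P i` are nonzero and represent pairwise distinct
points of projective space (no two are proportional). -/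
def ProjectivelyDistinct {K σ ι : Type*} [Field K] (P : ι → σ → K) : Prop :=
  (∀ i, P i ≠ 0) ∧ Pairwise fun i j => ∀ c : K, P i ≠ c • P j

/-- `α(J)`: the least degree of a nonzero homogeneous element of `J`. -/
def idealAlpha {K σ : Type*} [Field K] (J : Ideal (MvPolynomial σ K)) : ℕ :=
  sInf {d : ℕ | ∃ F ∈ J, F ≠ 0 ∧ MvPolynomial.IsHomogeneous F d}

theorem mem_ideal_of_eval_smul_eq_zero {K σ : Type*} [Field K] [Infinite K] {p : σ → K} {k : σ}
    {J : Ideal (MvPolynomial σ K)} (hJ : ∀ j, X j - C (p j / p k) * X k ∈ J)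
    {G : MvPolynomial σ K} (hG : ∀ c : K, eval (c • p) G = 0) : G ∈ J := by
  have h1 : Ideal.Quotient.mkₐ K J =
      (Ideal.Quotient.mkₐ K J).comp (aeval fun j => C (p j / p k) * X k) := by
    ext j
    simpa using Ideal.Quotient.eq.2 (hJ j)
  have h3 (x : σ → K) (F : MvPolynomial σ K) :
      eval x (aeval (fun j => C (p j / p k) * X k) F) = eval ((x k / p k) • p) F := by
    induction F using MvPolynomial.induction_on with
    | C a => simp
    | add f g hf hg => simp only [map_add, hf, hg]
    | mul_X f j hf =>
      rw [map_mul, map_mul, map_mul, hf]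
      simp only [aeval_X, map_mul, eval_C, eval_X, Pi.smul_apply, smul_eq_mul]
      ring
  have h2 : aeval (fun j => C (p j / p k) * X k) G = (0 : MvPolynomial σ K) :=
    MvPolynomial.funext fun x => by rw [h3, hG, map_zero]
  rw [← Ideal.Quotient.eq_zero_iff_mem, ← Ideal.Quotient.mkₐ_eq_mk K, h1, AlgHom.comp_apply, h2,
    map_zero]

theorem eval_smul_of_isHomogeneous {K σ : Type*} [Field K] {F : MvPolynomial σ K} {d : ℕ}
    (hF : F.IsHomogeneous d) (c : K) (p : σ → K) : eval (c • p) F = c ^ d * eval p F := by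
  rw [eval_eq, eval_eq, Finset.mul_sum]
  refine Finset.sum_congr rfl fun e he => ?_
  have hd : ∑ i ∈ e.support, e i = d := by
    rw [← hF (mem_support_iff.1 he), Pi.one_def, ← Finsupp.degree_eq_weight_one,
      Finsupp.degree_apply]
  simp only [Pi.smul_apply, smul_eq_mul, mul_pow, Finset.prod_mul_distrib,
    Finset.prod_pow_eq_pow_sum, hd]
  ring

theorem eval_smul_eq_zero_of_mem_homVanishingIdeal {K σ : Type*} [Field K] {p : σ → K}
    {G : MvPolynomial σ K} (hG : G ∈ homVanishingIdeal p) (c : K) : eval (c • p) G = 0 := by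
  have : homVanishingIdeal p ≤ RingHom.ker (eval (c • p)) := by
    refine Ideal.span_le.2 ?_
    rintro F ⟨⟨d, hd⟩, hF⟩
    simp [RingHom.mem_ker, eval_smul_of_isHomogeneous hd, hF]
  exact this hG

theorem X_sub_mem_homVanishingIdeal {K σ : Type*} [Field K] {p : σ → K} {k : σ} (hk : p k ≠ 0)
    (j : σ) : X j - C (p j / p k) * X k ∈ homVanishingIdeal p := by
  refine Ideal.subset_span ⟨⟨1, ?_⟩, by simp [hk]⟩
  refine (isHomogeneous_X K j).sub ?_
  simpa using (isHomogeneous_C σ (p j / p k)).mul (isHomogeneous_X K k)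

theorem mem_homVanishingIdeal_iff {K σ : Type*} [Field K] [Infinite K] {p : σ → K} (hp : p ≠ 0)
    {G : MvPolynomial σ K} : G ∈ homVanishingIdeal p ↔ ∀ c : K, eval (c • p) G = 0 := by
  obtain ⟨k, hk⟩ := Function.ne_iff.1 hp
  exact ⟨eval_smul_eq_zero_of_mem_homVanishingIdeal, fun h =>
    mem_ideal_of_eval_smul_eq_zero (X_sub_mem_homVanishingIdeal hk) h⟩

/-- The substitution `x ↦ ℓ(x) p + T (x - ℓ(x) p)`, where `ℓ(x) = x_k / p_k`. -/
def pencilHom {K σ : Type*} [Field K] (p : σ → K) (k : σ) :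
    MvPolynomial σ K →ₐ[K] Polynomial (MvPolynomial σ K) :=
  aeval fun j => Polynomial.C (C (p j / p k) * X k) +
    Polynomial.X * Polynomial.C (X j - C (p j / p k) * X k)

theorem pencilHom_mem_reesAlgebra {K σ : Type*} [Field K] {p : σ → K} {k : σ} (hk : p k ≠ 0)
    (G : MvPolynomial σ K) : pencilHom p k G ∈ reesAlgebra (homVanishingIdeal p) := by
  have hC (a : MvPolynomial σ K) : Polynomial.C a ∈ reesAlgebra (homVanishingIdeal p) :=
    Subalgebra.algebraMap_mem _ a
  induction G using MvPolynomial.induction_on with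
  | C a => simpa [pencilHom] using hC (C a)
  | add f g hf hg => rw [map_add]; exact add_mem hf hg
  | mul_X f j hf =>
    rw [map_mul]
    refine mul_mem hf ?_
    rw [pencilHom, aeval_X]
    refine add_mem (hC _) ?_
    rw [mul_comm, Polynomial.C_mul_X_eq_monomial, reesAlgebra.monomial_mem, pow_one]
    exact X_sub_mem_homVanishingIdeal hk j

theorem eval_one_pencilHom {K σ : Type*} [Field K] (p : σ → K) (k : σ)
    (G : MvPolynomial σ K) : (pencilHom p k G).eval 1 = G := by
  induction G using MvPolynomial.induction_on with
  | C a => simp [pencilHom]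
  | add f g hf hg => simp [hf, hg]
  | mul_X f j hf => rw [map_mul, Polynomial.eval_mul, hf]; simp [pencilHom]

theorem X_dvd_pencilHom {K σ : Type*} [Field K] [Infinite K] {p : σ → K} {k : σ}
    {G : MvPolynomial σ K} (hG : G ∈ homVanishingIdeal p) : Polynomial.X ∣ pencilHom p k G := by
  rw [Polynomial.X_dvd_iff]
  refine MvPolynomial.funext fun x => ?_
  rw [map_zero, ← eval_smul_eq_zero_of_mem_homVanishingIdeal hG (x k / p k)]
  clear hG
  induction G using MvPolynomial.induction_on with
  | C a => simp [pencilHom]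
  | add f g hf hg => simp [hf, hg]
  | mul_X f j hf =>
    rw [map_mul, Polynomial.mul_coeff_zero, map_mul, map_mul, hf]
    simp only [pencilHom, map_mul, aeval_X, Polynomial.coeff_add, Polynomial.coeff_C_zero,
      Polynomial.mul_coeff_zero, Polynomial.coeff_X_zero, zero_mul, add_zero, eval_C, eval_X,
      Pi.smul_apply, smul_eq_mul]
    ring

theorem mem_homVanishingIdeal_pow_iff {K σ : Type*} [Field K] [Infinite K] {p : σ → K} {k : σ}
    (hk : p k ≠ 0) (m : ℕ) {G : MvPolynomial σ K} :
    G ∈ homVanishingIdeal p ^ m ↔ Polynomial.X ^ m ∣ pencilHom p k G := by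
  constructor
  · intro hG
    have h : (homVanishingIdeal p).map (pencilHom p k) ≤ Ideal.span {Polynomial.X} :=
      Ideal.map_le_iff_le_comap.2 fun F hF => Ideal.mem_span_singleton.2 (X_dvd_pencilHom hF)
    have h2 := Ideal.pow_right_mono h m (Ideal.map_pow (pencilHom p k) _ m ▸
      Ideal.mem_map_of_mem _ hG)
    rwa [Ideal.span_singleton_pow, Ideal.mem_span_singleton] at h2
  · intro h
    rw [← eval_one_pencilHom p k G, Polynomial.eval_eq_sum]
    refine Ideal.sum_mem _ fun i hi => ?_
    simp only [one_pow, mul_one]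
    by_cases him : i < m
    · rw [Polynomial.X_pow_dvd_iff.1 h i him]
      exact zero_mem _
    · exact Ideal.pow_le_pow_right (not_lt.1 him) (pencilHom_mem_reesAlgebra hk G i)

theorem mem_homVanishingIdeal_pow_of_mul_mem {K σ : Type*} [Field K] [Infinite K] {p : σ → K}
    (hp : p ≠ 0) {F G : MvPolynomial σ K} (hF2 : F ∉ homVanishingIdeal p ^ 2) {m : ℕ}
    (h : F * G ∈ homVanishingIdeal p ^ (m + 1)) : G ∈ homVanishingIdeal p ^ m := by
  obtain ⟨k, hk⟩ := Function.ne_iff.1 hp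
  rw [Pi.zero_apply] at hk
  rw [mem_homVanishingIdeal_pow_iff hk] at h hF2 ⊢
  rw [map_mul] at h
  by_cases hF : Polynomial.X ∣ pencilHom p k F
  · obtain ⟨q, hq⟩ := hF
    rw [hq, pow_two, mul_dvd_mul_iff_left Polynomial.X_ne_zero] at hF2
    rw [hq, pow_succ', mul_assoc, mul_dvd_mul_iff_left Polynomial.X_ne_zero] at h
    exact Polynomial.prime_X.pow_dvd_of_dvd_mul_left _ hF2 h
  · exact (pow_dvd_pow _ m.le_succ).trans (Polynomial.prime_X.pow_dvd_of_dvd_mul_left _ hF h)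

theorem eval_pderiv_eq_zero_of_mem_sq {K σ : Type*} [Field K] {p : σ → K} {F : MvPolynomial σ K}
    (hF : F ∈ homVanishingIdeal p ^ 2) (i : σ) : eval p (pderiv i F) = 0 := by
  have h0 {G : MvPolynomial σ K} (hG : G ∈ homVanishingIdeal p) : eval p G = 0 := by
    simpa using eval_smul_eq_zero_of_mem_homVanishingIdeal hG 1
  rw [pow_two] at hF
  induction hF using Submodule.mul_induction_on' with
  | mem_mul_mem f hf g hg => simp [h0 hf, h0 hg, Derivation.leibniz]
  | add f _ g _ hf hg => simp [hf, hg]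

/-- Linear substitution of variables by a matrix. -/
def linSubst {K : Type*} [Field K] (M : Matrix (Fin 3) (Fin 3) K) :
    MvPolynomial (Fin 3) K →ₐ[K] MvPolynomial (Fin 3) K :=
  aeval fun j => ∑ i, C (M j i) * X i

theorem eval_linSubst {K : Type*} [Field K] (M : Matrix (Fin 3) (Fin 3) K) (v : Fin 3 → K)
    (G : MvPolynomial (Fin 3) K) : eval v (linSubst M G) = eval (M.mulVec v) G := by
  induction G using MvPolynomial.induction_on with
  | C a => simp [linSubst]
  | add f g hf hg => simp [hf, hg]
  | mul_X f j hf => rw [map_mul, map_mul, map_mul, hf]; simp [linSubst, Matrix.mulVec, dotProduct]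

theorem linSubst_linSubst {K : Type*} [Field K] [Infinite K] {M N : Matrix (Fin 3) (Fin 3) K}
    (h : M * N = 1) (G : MvPolynomial (Fin 3) K) : linSubst N (linSubst M G) = G :=
  MvPolynomial.funext fun v => by
    rw [eval_linSubst, eval_linSubst, Matrix.mulVec_mulVec, h, Matrix.one_mulVec]

/-- The pullback of forms to the standard conic `x₀² = x₁ x₂` along `(s, t) ↦ (st, s², t²)`. -/
def conicHom (K : Type*) [Field K] : MvPolynomial (Fin 3) K →ₐ[K] MvPolynomial (Fin 2) K :=
  aeval ![X 0 * X 1, X 0 ^ 2, X 1 ^ 2]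

theorem eval_conicHom {K : Type*} [Field K] (v : Fin 2 → K) (G : MvPolynomial (Fin 3) K) :
    eval v (conicHom K G) = eval ![v 0 * v 1, v 0 ^ 2, v 1 ^ 2] G := by
  induction G using MvPolynomial.induction_on with
  | C a => simp [conicHom]
  | add f g hf hg => simp only [map_add, hf, hg]
  | mul_X f j hf =>
    rw [map_mul, map_mul, map_mul, hf]
    fin_cases j <;> simp [conicHom]

theorem isWeightedHomogeneous_conicHom {K : Type*} [Field K] (G : MvPolynomial (Fin 3) K) :
    IsWeightedHomogeneous (fun _ => (1 : ZMod 2)) (conicHom K G) 0 := by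
  have hX (i : Fin 2) := isWeightedHomogeneous_X K (fun _ => (1 : ZMod 2)) i
  induction G using MvPolynomial.induction_on with
  | C a => simpa [conicHom] using isWeightedHomogeneous_C _ a
  | add f g hf hg => rw [map_add]; exact hf.add hg
  | mul_X f j hf =>
    rw [map_mul, ← add_zero (0 : ZMod 2)]
    refine hf.mul ?_
    have h2 : (0 : ZMod 2) = 1 + 1 := by decide
    fin_cases j
    · simpa [conicHom, h2] using (hX 0).mul (hX 1)
    · simpa [conicHom, h2, pow_two] using (hX 0).mul (hX 0)
    · simpa [conicHom, h2, pow_two] using (hX 1).mul (hX 1)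

theorem eq_zero_of_add_eq_zero_of_isWeightedHomogeneous {K σ M : Type*} [Field K]
    [AddCommMonoid M] {w : σ → M} {a b : M} (hab : a ≠ b) {F G : MvPolynomial σ K}
    (hF : IsWeightedHomogeneous w F a) (hG : IsWeightedHomogeneous w G b) (h : F + G = 0) :
    F = 0 ∧ G = 0 := by
  have hF0 : F = 0 := by
    by_contra hF0
    rw [eq_neg_of_add_eq_zero_right h] at hG
    exact hab (hF.inj_right hF0 (by simpa using hG.neg))
  exact ⟨hF0, by simpa [hF0] using h⟩

theorem exists_eq_conicHom_add {K : Type*} [Field K] (h : MvPolynomial (Fin 2) K) :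
    ∃ u v w, h = conicHom K u + (X 0 * conicHom K v + X 1 * conicHom K w) := by
  induction h using MvPolynomial.induction_on with
  | C a => exact ⟨C a, 0, 0, by simp [conicHom]⟩
  | add f g hf hg =>
    obtain ⟨u, v, w, rfl⟩ := hf
    obtain ⟨u', v', w', rfl⟩ := hg
    exact ⟨u + u', v + v', w + w', by simp only [map_add]; ring⟩
  | mul_X f j hf =>
    obtain ⟨u, v, w, rfl⟩ := hf
    fin_cases j
    · exact ⟨X 1 * v + X 0 * w, u, 0, by simp [conicHom]; ring⟩
    · exact ⟨X 0 * v + X 2 * w, 0, u, by simp [conicHom]; ring⟩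

theorem isWeightedHomogeneous_odd_part {K : Type*} [Field K] (v w : MvPolynomial (Fin 3) K) :
    IsWeightedHomogeneous (fun _ => (1 : ZMod 2))
      (X 0 * conicHom K v + X 1 * conicHom K w) 1 := by
  have hX (i : Fin 2) (v : MvPolynomial (Fin 3) K) : IsWeightedHomogeneous
      (fun _ => (1 : ZMod 2)) (X i * conicHom K v) 1 := by
    simpa using (isWeightedHomogeneous_X K (fun _ => (1 : ZMod 2)) i).mul
      (isWeightedHomogeneous_conicHom v)
  exact (hX 0 v).add (hX 1 w)

theorem exists_eq_conicHom_of_even {K : Type*} [Field K] {h : MvPolynomial (Fin 2) K}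
    (hh : IsWeightedHomogeneous (fun _ => (1 : ZMod 2)) h 0) : ∃ u, h = conicHom K u := by
  obtain ⟨u, v, w, rfl⟩ := exists_eq_conicHom_add h
  have h1 := hh.sub (isWeightedHomogeneous_conicHom u)
  have := (eq_zero_of_add_eq_zero_of_isWeightedHomogeneous (by decide) h1
    (isWeightedHomogeneous_odd_part v w).neg (by ring)).2
  exact ⟨u, by rw [neg_eq_zero.1 this, add_zero]⟩

theorem exists_of_even_mul_eq_conicHom {K : Type*} [Field K] {f h : MvPolynomial (Fin 2) K}
    {G : MvPolynomial (Fin 3) K} (hf : IsWeightedHomogeneous (fun _ => (1 : ZMod 2)) f 0)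
    (hf0 : f ≠ 0) (hG : conicHom K G = f * h) : ∃ u, h = conicHom K u := by
  obtain ⟨u, v, w, rfl⟩ := exists_eq_conicHom_add h
  have h1 := (isWeightedHomogeneous_conicHom G).sub (hf.mul (isWeightedHomogeneous_conicHom u))
  have h2 := hf.mul (isWeightedHomogeneous_odd_part v w)
  have := (eq_zero_of_add_eq_zero_of_isWeightedHomogeneous (by decide) h1 h2.neg
    (by rw [hG]; ring)).2
  rw [neg_eq_zero, mul_eq_zero, or_iff_right hf0] at this
  exact ⟨u, by rw [this, add_zero]⟩

theorem exists_of_odd_mul_eq_conicHom {K : Type*} [Field K] {f h : MvPolynomial (Fin 2) K}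
    {G : MvPolynomial (Fin 3) K} (hf : IsWeightedHomogeneous (fun _ => (1 : ZMod 2)) f 1)
    (hf0 : f ≠ 0) (hG : conicHom K G = f * h) :
    ∃ v w, h = X 0 * conicHom K v + X 1 * conicHom K w := by
  obtain ⟨u, v, w, rfl⟩ := exists_eq_conicHom_add h
  have h1 := (isWeightedHomogeneous_conicHom G).sub (hf.mul (isWeightedHomogeneous_odd_part v w))
  have h2 := hf.mul (isWeightedHomogeneous_conicHom u)
  have := (eq_zero_of_add_eq_zero_of_isWeightedHomogeneous (by decide) h1 h2.neg
    (by rw [hG]; ring)).2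
  rw [neg_eq_zero, mul_eq_zero, or_iff_right hf0] at this
  exact ⟨v, w, by rw [this, zero_add]⟩

theorem exists_eq_mul_add_rename {K : Type*} [Field K] (G : MvPolynomial (Fin 3) K) :
    ∃ q a b, G = (X 0 ^ 2 - X 1 * X 2) * q + rename Fin.succ a + X 0 * rename Fin.succ b := by
  induction G using MvPolynomial.induction_on with
  | C a => exact ⟨0, C a, 0, by simp⟩
  | add f g hf hg =>
    obtain ⟨q, a, b, rfl⟩ := hf
    obtain ⟨q', a', b', rfl⟩ := hg
    exact ⟨q + q', a + a', b + b', by simp only [map_add]; ring⟩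
  | mul_X f j hf =>
    obtain ⟨q, a, b, rfl⟩ := hf
    fin_cases j
    · exact ⟨q * X 0 + rename Fin.succ b, X 0 * X 1 * b, a, by simp; ring⟩
    · exact ⟨q * X 1, a * X 0, b * X 0, by simp; ring⟩
    · exact ⟨q * X 2, a * X 1, b * X 1, by simp; ring⟩

theorem dvd_of_conicHom_eq_zero {K : Type*} [Field K] {G : MvPolynomial (Fin 3) K}
    (hG : conicHom K G = 0) : X 0 ^ 2 - X 1 * X 2 ∣ G := by
  obtain ⟨q, a, b, rfl⟩ := exists_eq_mul_add_rename G
  have hr (a : MvPolynomial (Fin 2) K) : conicHom K (rename Fin.succ a) = expand 2 a := by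
    have h : (conicHom K).comp (rename Fin.succ) = expand 2 := by
      ext1 j
      fin_cases j <;> simp [conicHom]
    exact DFunLike.congr_fun h a
  let w : Fin 2 → ZMod 2 := ![1, 0]
  have he (a : MvPolynomial (Fin 2) K) : IsWeightedHomogeneous w (expand 2 a) 0 := by
    induction a using MvPolynomial.induction_on with
    | C a => simpa using isWeightedHomogeneous_C _ a
    | add f g hf hg => rw [map_add]; exact hf.add hg
    | mul_X f j hf =>
      rw [map_mul, ← add_zero (0 : ZMod 2)]
      refine hf.mul ?_
      rw [expand_X]
      have h0 : 2 • w j = 0 := by rw [two_nsmul]; exact CharTwo.add_self_eq_zero _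
      exact h0 ▸ (isWeightedHomogeneous_X K w j).pow 2
  have hb : IsWeightedHomogeneous w (X 0 * X 1 * expand 2 b) 1 := by
    simpa [w] using ((isWeightedHomogeneous_X K w 0).mul (isWeightedHomogeneous_X K w 1)).mul (he b)
  have h0 : expand 2 a + X 0 * X 1 * expand 2 b = 0 := by
    have hC : conicHom K (X 0 ^ 2 - X 1 * X 2) = 0 := by
      simp [conicHom]
      ring
    have hX : conicHom K (X 0) = X 0 * X 1 := by simp [conicHom]
    rwa [map_add, map_add, map_mul, map_mul, hr, hr, hC, hX, zero_mul, zero_add] at hG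
  obtain ⟨ha0, hb0⟩ := eq_zero_of_add_eq_zero_of_isWeightedHomogeneous (by decide) (he a) hb h0
  rw [expand_eq_zero two_pos] at ha0
  rw [mul_eq_zero, or_iff_right (mul_ne_zero (X_ne_zero _) (X_ne_zero _)),
    expand_eq_zero two_pos] at hb0
  simp [ha0, hb0]

theorem exists_eq_of_isHomogeneous_two {K : Type*} [Field K] {Q : MvPolynomial (Fin 3) K}
    (hQ : Q.IsHomogeneous 2) : ∃ a b c d e f : K, Q = C a * X 0 ^ 2 + C b * X 1 ^ 2 +
      C c * X 2 ^ 2 + C d * (X 0 * X 1) + C e * (X 0 * X 2) + C f * (X 1 * X 2) := by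
  rw [Q.as_sum]
  refine Finset.sum_induction _ (fun Q : MvPolynomial (Fin 3) K => ∃ a b c d e f : K,
    Q = C a * X 0 ^ 2 + C b * X 1 ^ 2 + C c * X 2 ^ 2 + C d * (X 0 * X 1) + C e * (X 0 * X 2) +
      C f * (X 1 * X 2)) ?_ ⟨0, 0, 0, 0, 0, 0, by simp⟩ ?_
  · rintro _ _ ⟨a, b, c, d, e, f, rfl⟩ ⟨a', b', c', d', e', f', rfl⟩
    exact ⟨a + a', b + b', c + c', d + d', e + e', f + f', by simp only [map_add]; ring⟩
  · intro m hm
    have h2 := hQ (mem_support_iff.1 hm)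
    rw [Pi.one_def, ← Finsupp.degree_eq_weight_one, Finsupp.degree_eq_sum,
      Fin.sum_univ_three] at h2
    rw [monomial_eq, Finsupp.prod_fintype _ _ (by simp), Fin.prod_univ_three]
    generalize coeff m Q = k
    generalize m 0 = x at *
    generalize m 1 = y at *
    generalize m 2 = z at *
    obtain ⟨rfl, rfl, rfl⟩ | ⟨rfl, rfl, rfl⟩ | ⟨rfl, rfl, rfl⟩ | ⟨rfl, rfl, rfl⟩ |
        ⟨rfl, rfl, rfl⟩ | ⟨rfl, rfl, rfl⟩ : (x = 2 ∧ y = 0 ∧ z = 0) ∨ (x = 0 ∧ y = 2 ∧ z = 0) ∨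
        (x = 0 ∧ y = 0 ∧ z = 2) ∨ (x = 1 ∧ y = 1 ∧ z = 0) ∨ (x = 1 ∧ y = 0 ∧ z = 1) ∨
        (x = 0 ∧ y = 1 ∧ z = 1) := by lia
    · exact ⟨k, 0, 0, 0, 0, 0, by simp⟩
    · exact ⟨0, k, 0, 0, 0, 0, by simp⟩
    · exact ⟨0, 0, k, 0, 0, 0, by simp⟩
    · exact ⟨0, 0, 0, k, 0, 0, by simp⟩
    · exact ⟨0, 0, 0, 0, k, 0, by simp⟩
    · exact ⟨0, 0, 0, 0, 0, k, by simp⟩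

theorem exists_linSubst_eq_neg {K : Type*} [Field K] [IsAlgClosed K]
    {Q : MvPolynomial (Fin 3) K} (hQ : Q.IsHomogeneous 2)
    (hsm : ∀ p : Fin 3 → K, p ≠ 0 → eval p Q = 0 → ∃ i, eval p (pderiv i Q) ≠ 0)
    {p : Fin 3 → K} (hp : p ≠ 0) (hpQ : eval p Q = 0) :
    ∃ M : Matrix (Fin 3) (Fin 3) K, IsUnit M.det ∧ linSubst M Q = -(X 0 ^ 2 - X 1 * X 2) := by
  obtain ⟨a, b, c, d, e, f, hQe⟩ := exists_eq_of_isHomogeneous_two hQ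
  let q (v : Fin 3 → K) : K := a * v 0 ^ 2 + b * v 1 ^ 2 + c * v 2 ^ 2 + d * (v 0 * v 1) +
    e * (v 0 * v 2) + f * (v 1 * v 2)
  let g (v : Fin 3 → K) : Fin 3 → K := ![2 * a * v 0 + d * v 1 + e * v 2,
    2 * b * v 1 + d * v 0 + f * v 2, 2 * c * v 2 + e * v 0 + f * v 1]
  have hq (v : Fin 3 → K) : eval v Q = q v := by simp [hQe, q]
  have hg (v : Fin 3 → K) (i : Fin 3) : eval v (pderiv i Q) = g v i := by
    fin_cases i <;> simp [hQe, g, Derivation.leibniz, pderiv_X] <;> ring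
  simp only [hq, hg] at hsm hpQ
  have hgp : g p 0 * p 0 + g p 1 * p 1 + g p 2 * p 2 = 0 := by
    simp only [q, g] at hpQ ⊢
    simp
    linear_combination 2 * hpQ
  obtain ⟨i, hi⟩ := hsm p hp hpQ
  obtain ⟨u, hu, huQ⟩ : ∃ u, g p 0 * u 0 + g p 1 * u 1 + g p 2 * u 2 = 1 ∧ q u = 0 := by
    obtain ⟨u, hu⟩ : ∃ u : Fin 3 → K, g p 0 * u 0 + g p 1 * u 1 + g p 2 * u 2 = 1 := by
      refine ⟨Pi.single i (g p i)⁻¹, ?_⟩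
      fin_cases i <;> simpa using mul_inv_cancel₀ hi
    refine ⟨u - q u • p, ?_, ?_⟩
    · simp only [Pi.sub_apply, Pi.smul_apply, smul_eq_mul]
      linear_combination hu - q u * hgp
    · have (α : K) : q (u - α • p) = q u - α * (g p 0 * u 0 + g p 1 * u 1 + g p 2 * u 2) +
          α ^ 2 * q p := by
        simp [q, g]
        ring
      rw [this, hu, hpQ]
      ring
  obtain ⟨w, hw, hwu, hdet⟩ : ∃ w : Fin 3 → K, g p 0 * w 0 + g p 1 * w 1 + g p 2 * w 2 = 0 ∧
      g w 0 * u 0 + g w 1 * u 1 + g w 2 * u 2 = 0 ∧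
      w 0 * (p 1 * u 2 - p 2 * u 1) + w 1 * (p 2 * u 0 - p 0 * u 2) +
        w 2 * (p 0 * u 1 - p 1 * u 0) ≠ 0 := by
    obtain ⟨w, hw, hdet⟩ : ∃ w : Fin 3 → K, g p 0 * w 0 + g p 1 * w 1 + g p 2 * w 2 = 0 ∧
        w 0 * (p 1 * u 2 - p 2 * u 1) + w 1 * (p 2 * u 0 - p 0 * u 2) +
          w 2 * (p 0 * u 1 - p 1 * u 0) ≠ 0 := by
      obtain ⟨x, hx⟩ : ∃ x : Fin 3 → K, x 0 * (p 1 * u 2 - p 2 * u 1) +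
          x 1 * (p 2 * u 0 - p 0 * u 2) + x 2 * (p 0 * u 1 - p 1 * u 0) ≠ 0 := by
        by_contra! h
        have h0 := h ![1, 0, 0]
        have h1 := h ![0, 1, 0]
        have h2 := h ![0, 0, 1]
        simp at h0 h1 h2
        apply hp
        ext j
        fin_cases j
        · simp; linear_combination (-p 0) * hu + u 0 * hgp + g p 1 * h2 - g p 2 * h1
        · simp; linear_combination (-p 1) * hu + u 1 * hgp + g p 2 * h0 - g p 0 * h2
        · simp; linear_combination (-p 2) * hu + u 2 * hgp + g p 0 * h1 - g p 1 * h0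
      refine ⟨x - (g p 0 * x 0 + g p 1 * x 1 + g p 2 * x 2) • u, ?_, ?_⟩
      · simp only [Pi.sub_apply, Pi.smul_apply, smul_eq_mul]
        linear_combination (-(g p 0 * x 0 + g p 1 * x 1 + g p 2 * x 2)) * hu
      · convert hx using 1
        simp only [Pi.sub_apply, Pi.smul_apply, smul_eq_mul]
        ring
    refine ⟨w - (g w 0 * u 0 + g w 1 * u 1 + g w 2 * u 2) • p, ?_, ?_, ?_⟩
    · simp only [Pi.sub_apply, Pi.smul_apply, smul_eq_mul]
      linear_combination hw - (g w 0 * u 0 + g w 1 * u 1 + g w 2 * u 2) * hgp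
    · generalize hβ : g w 0 * u 0 + g w 1 * u 1 + g w 2 * u 2 = β
      simp [g] at hu hβ ⊢
      linear_combination hβ - β * hu
    · convert hdet using 1
      simp only [Pi.sub_apply, Pi.smul_apply, smul_eq_mul]
      ring
  have hwQ : q w ≠ 0 := by
    intro h0
    have hw0 : w ≠ 0 := by
      rintro rfl
      simp at hdet
    obtain ⟨j, hj⟩ := hsm w hw0 h0
    have e1 : g w 0 * p 0 + g w 1 * p 1 + g w 2 * p 2 = 0 := by
      simp [g] at hw ⊢
      linear_combination hw
    have e2 : g w 0 * w 0 + g w 1 * w 1 + g w 2 * w 2 = 0 := by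
      simp [g, q] at h0 ⊢
      linear_combination 2 * h0
    apply hj
    apply (mul_eq_zero_iff_right hdet).1
    fin_cases j
    · simp only [Fin.zero_eta]
      linear_combination (p 1 * u 2 - p 2 * u 1) * e2 + (u 1 * w 2 - u 2 * w 1) * e1 +
        (w 1 * p 2 - w 2 * p 1) * hwu
    · simp only [Fin.mk_one]
      linear_combination (p 2 * u 0 - p 0 * u 2) * e2 + (u 2 * w 0 - u 0 * w 2) * e1 +
        (w 2 * p 0 - w 0 * p 2) * hwu
    · simp only [Fin.reduceFinMk]
      linear_combination (p 0 * u 1 - p 1 * u 0) * e2 + (u 0 * w 1 - u 1 * w 0) * e1 +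
        (w 0 * p 1 - w 1 * p 0) * hwu
  obtain ⟨δ, hδ⟩ := IsAlgClosed.exists_pow_nat_eq (-(q w)⁻¹) two_pos
  have hδ0 : δ ≠ 0 := by
    rintro rfl
    simp [hwQ] at hδ
  have hδq : δ ^ 2 * q w = -1 := by
    rw [hδ, neg_mul, inv_mul_cancel₀ hwQ]
  refine ⟨!![δ * w 0, p 0, u 0; δ * w 1, p 1, u 1; δ * w 2, p 2, u 2], ?_, ?_⟩
  · rw [isUnit_iff_ne_zero]
    convert mul_ne_zero hδ0 hdet using 1
    simp [Matrix.det_fin_three]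
    ring
  · refine MvPolynomial.funext fun x => ?_
    rw [eval_linSubst, hq]
    simp [q, g, dotProduct, Fin.sum_univ_three] at hδq hw hwu hpQ huQ hu ⊢
    linear_combination x 0 ^ 2 * hδq + x 1 ^ 2 * hpQ + x 2 ^ 2 * huQ + x 0 * x 1 * δ * hw +
      x 0 * x 2 * δ * hwu + x 1 * x 2 * hu

/-- The linear form on `K²` vanishing at `v`. -/
def lineForm {K : Type*} [Field K] (v : Fin 2 → K) : MvPolynomial (Fin 2) K :=
  C (v 1) * X 0 - C (v 0) * X 1

theorem isHomogeneous_lineForm {K : Type*} [Field K] (v : Fin 2 → K) :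
    (lineForm v).IsHomogeneous 1 := by
  have h (c : K) (i : Fin 2) : (C c * X i).IsHomogeneous 1 := by
    simpa using (isHomogeneous_C (Fin 2) c).mul (isHomogeneous_X K i)
  exact (h _ _).sub (h _ _)

theorem isWeightedHomogeneous_lineForm {K : Type*} [Field K] (v : Fin 2 → K) :
    IsWeightedHomogeneous (fun _ => (1 : ZMod 2)) (lineForm v) 1 := by
  have h (c : K) (i : Fin 2) : IsWeightedHomogeneous (fun _ => (1 : ZMod 2)) (C c * X i) 1 :=
    (isWeightedHomogeneous_X K (fun _ => (1 : ZMod 2)) i).C_mul c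
  exact (h _ _).sub (h _ _)

theorem irreducible_lineForm {K : Type*} [Field K] {v : Fin 2 → K} (hv : v ≠ 0) :
    Irreducible (lineForm v) := by
  have h0 : lineForm v ≠ 0 := by
    intro h
    apply hv
    have h1 := congrArg (eval ![1, 0]) h
    have h2 := congrArg (eval ![0, 1]) h
    simp [lineForm] at h1 h2
    ext i
    fin_cases i <;> simp [h1, h2]
  refine irreducible_of_totalDegree_eq_one ((isHomogeneous_lineForm v).totalDegree h0) ?_
  intro x hx
  obtain ⟨m, hm⟩ := ne_zero_iff.1 h0
  rw [isUnit_iff_ne_zero]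
  rintro rfl
  exact hm (zero_dvd_iff.1 (hx m))

theorem lineForm_dvd {K : Type*} [Field K] [Infinite K] {v : Fin 2 → K} (hv : v ≠ 0)
    {G : MvPolynomial (Fin 2) K} (hG : ∀ c : K, eval (c • v) G = 0) : lineForm v ∣ G := by
  obtain ⟨k, hk⟩ := Function.ne_iff.1 hv
  rw [Pi.zero_apply] at hk
  rw [← Ideal.mem_span_singleton]
  refine mem_ideal_of_eval_smul_eq_zero (p := v) (k := k) (fun j => ?_) hG
  rw [Ideal.mem_span_singleton]
  have h (a b : K) (hb : b ≠ 0) (x y : MvPolynomial (Fin 2) K) :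
      x - C (a / b) * y = C b⁻¹ * (C b * x - C a * y) := by
    rw [mul_sub, ← mul_assoc, ← mul_assoc, ← C_mul, ← C_mul, inv_mul_cancel₀ hb, C_1, one_mul,
      div_eq_inv_mul]
  rw [h _ _ hk]
  refine Dvd.dvd.mul_left ?_ _
  fin_cases k <;> fin_cases j
  · simp
  · exact ⟨-1, by simp [lineForm]⟩
  · exact ⟨1, by simp [lineForm]⟩
  · simp

theorem exists_conic_param {K : Type*} [Field K] [IsAlgClosed K] {x : Fin 3 → K}
    (hx : x 0 ^ 2 = x 1 * x 2) : ∃ v : Fin 2 → K, x = ![v 0 * v 1, v 0 ^ 2, v 1 ^ 2] := by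
  obtain ⟨a, ha⟩ := IsAlgClosed.exists_pow_nat_eq (x 1) two_pos
  obtain ⟨b, hb⟩ := IsAlgClosed.exists_pow_nat_eq (x 2) two_pos
  have h : (x 0) ^ 2 = (a * b) ^ 2 := by rw [hx, mul_pow, ha, hb]
  rcases sq_eq_sq_iff_eq_or_eq_neg.1 h with h | h
  · refine ⟨![a, b], ?_⟩
    ext j
    fin_cases j <;> simp [h, ha, hb]
  · refine ⟨![a, -b], ?_⟩
    ext j
    fin_cases j <;> simp [h, ha, hb]

theorem lineForm_pow_dvd {K : Type*} [Field K] [Infinite K]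
    {φ : MvPolynomial (Fin 3) K →ₐ[K] MvPolynomial (Fin 2) K}
    {p : Fin 3 → K} {v : Fin 2 → K} (hv : v ≠ 0)
    (hφ : ∀ (c : K) (G), eval (c • v) (φ G) = eval (c ^ 2 • p) G) (m : ℕ)
    {G : MvPolynomial (Fin 3) K} (hG : G ∈ homVanishingIdeal p ^ m) : lineForm v ^ m ∣ φ G := by
  have h : (homVanishingIdeal p).map φ ≤ Ideal.span {lineForm v} :=
    Ideal.map_le_iff_le_comap.2 fun F hF => Ideal.mem_span_singleton.2 <| lineForm_dvd hv
      fun c => by rw [hφ, eval_smul_eq_zero_of_mem_homVanishingIdeal hF]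
  have h2 := Ideal.pow_right_mono h m (Ideal.map_pow φ _ m ▸ Ideal.mem_map_of_mem _ hG)
  rwa [Ideal.span_singleton_pow, Ideal.mem_span_singleton] at h2

theorem mem_homVanishingIdeal_of_lineForm_dvd {K : Type*} [Field K] [IsAlgClosed K]
    {φ : MvPolynomial (Fin 3) K →ₐ[K] MvPolynomial (Fin 2) K}
    {p : Fin 3 → K} (hp : p ≠ 0) {v : Fin 2 → K}
    (hφ : ∀ (c : K) (G), eval (c • v) (φ G) = eval (c ^ 2 • p) G)
    {G : MvPolynomial (Fin 3) K} (hG : lineForm v ∣ φ G) : G ∈ homVanishingIdeal p := by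
  have := IsAlgClosed.instInfinite (K := K)
  rw [mem_homVanishingIdeal_iff hp]
  intro c
  obtain ⟨d, rfl⟩ := IsAlgClosed.exists_pow_nat_eq c two_pos
  obtain ⟨h, hh⟩ := hG
  rw [← hφ, hh]
  simp [lineForm]
  left
  ring

theorem prod_lineForm_pow_dvd {K ι : Type*} [Field K] [Fintype ι]
    {v : ι → Fin 2 → K} (hv : ∀ i, v i ≠ 0)
    (hvv : Pairwise fun i j => ¬ lineForm (v i) ∣ lineForm (v j)) {m : ℕ}
    {H : MvPolynomial (Fin 2) K} (hH : ∀ i, lineForm (v i) ^ m ∣ H) :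
    (∏ i, lineForm (v i)) ^ m ∣ H := by
  rw [← Finset.prod_pow]
  refine Fintype.prod_dvd_of_isRelPrime (fun i j hij => ?_) hH
  exact ((irreducible_lineForm (hv i)).isRelPrime_iff_not_dvd.2 (hvv hij)).pow

theorem mem_symbPow {K σ ι : Type*} [Field K] {P : ι → σ → K} {m : ℕ} {G : MvPolynomial σ K} :
    G ∈ symbPow P m ↔ ∀ i, G ∈ homVanishingIdeal (P i) ^ m := by
  rw [symbPow, Ideal.mem_iInf]

theorem symbPow_pow_le {K σ ι : Type*} [Field K] (P : ι → σ → K) (m r : ℕ) :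
    symbPow P m ^ r ≤ symbPow P (m * r) := by
  refine le_iInf fun i => ?_
  rw [pow_mul]
  exact Ideal.pow_right_mono (iInf_le _ i) r

theorem mul_mem_symbPow {K σ ι : Type*} [Field K] {P : ι → σ → K} {k l : ℕ}
    {F G : MvPolynomial σ K} (hF : F ∈ symbPow P k) (hG : G ∈ symbPow P l) :
    F * G ∈ symbPow P (k + l) :=
  mem_symbPow.2 fun i => pow_add (homVanishingIdeal (P i)) k l ▸
    Ideal.mul_mem_mul (mem_symbPow.1 hF i) (mem_symbPow.1 hG i)

theorem symbPow_two_mul_le_of_lifts {K ι : Type*} [Field K] {P : ι → Fin 3 → K}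
    {Q : MvPolynomial (Fin 3) K} (hQ : Q ∈ symbPow P 1)
    (hcolon : ∀ (m : ℕ) (G), Q * G ∈ symbPow P (m + 1) → G ∈ symbPow P m)
    {α : MvPolynomial (Fin 3) K →ₐ[K] MvPolynomial (Fin 3) K} (hα : Function.Surjective α)
    {φ : MvPolynomial (Fin 3) K →ₐ[K] MvPolynomial (Fin 2) K} (hφα : ∀ G, φ G = conicHom K (α G))
    (hker : ∀ G, φ G = 0 → Q ∣ G)
    {f : MvPolynomial (Fin 2) K} (hf0 : f ≠ 0)
    (hf1 : IsWeightedHomogeneous (fun _ => (1 : ZMod 2)) f 1)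
    (hdvd : ∀ (m : ℕ), ∀ G ∈ symbPow P m, f ^ m ∣ φ G)
    {A A' B : MvPolynomial (Fin 3) K} (hA : A ∈ symbPow P 1) (hφA : φ A = f * X 0)
    (hA' : A' ∈ symbPow P 1) (hφA' : φ A' = f * X 1) (hB : B ∈ symbPow P 2) (hφB : φ B = f ^ 2)
    (r : ℕ) : symbPow P (2 * r) ≤ symbPow P 2 ^ r := by
  have hmul {F G} (hF : F ∈ symbPow P 1) (hG : G ∈ symbPow P 1) : F * G ∈ symbPow P 2 := by
    have h := mul_mem_symbPow (k := 1) (l := 1) hF hG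
    rwa [one_add_one_eq_two] at h
  have hBpow (r : ℕ) : B ^ r ∈ symbPow P (2 * r) :=
    symbPow_pow_le P 2 r (Ideal.pow_mem_pow hB r)
  induction r with
  | zero => rw [pow_zero, Ideal.one_eq_top]; exact le_top
  | succ r ih =>
    intro G hG
    obtain ⟨h, hh⟩ := hdvd _ _ hG
    obtain ⟨u, rfl⟩ : ∃ u, h = φ u := by
      obtain ⟨u, rfl⟩ := exists_of_even_mul_eq_conicHom (G := α G)
        (by simpa [two_mul, pow_add, CharTwo.add_self_eq_zero] using hf1.pow (2 * (r + 1)))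
        (pow_ne_zero _ hf0) (hφα G ▸ hh)
      obtain ⟨u, rfl⟩ := hα u
      exact ⟨u, (hφα u).symm⟩
    obtain ⟨G', hG'⟩ := hker (G - B ^ (r + 1) * u) <| by
      rw [map_sub, map_mul, map_pow, hφB, hh, pow_mul, sub_self]
    have hG'mem : G' ∈ symbPow P (2 * r + 1) :=
      hcolon _ _ (hG' ▸ sub_mem hG (Ideal.mul_mem_right _ _ (hBpow (r + 1))))
    obtain ⟨h', hh'⟩ := hdvd _ _ hG'mem
    obtain ⟨w, w', rfl⟩ : ∃ w w', h' = X 0 * φ w + X 1 * φ w' := by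
      obtain ⟨w, w', rfl⟩ := exists_of_odd_mul_eq_conicHom (G := α G')
        (by simpa [two_mul, CharTwo.add_self_eq_zero] using hf1.pow (2 * r + 1))
        (pow_ne_zero _ hf0) (hφα G' ▸ hh')
      obtain ⟨w, rfl⟩ := hα w
      obtain ⟨w', rfl⟩ := hα w'
      exact ⟨w, w', by rw [hφα, hφα]⟩
    obtain ⟨G'', hG''⟩ := hker (G' - B ^ r * (A * w + A' * w')) <| by
      rw [map_sub, map_mul, map_pow, map_add, map_mul, map_mul, hφB, hφA, hφA', hh']
      ring
    have hG''mem : G'' ∈ symbPow P (2 * r) := by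
      refine hcolon _ _ (hG'' ▸ sub_mem hG'mem ?_)
      rw [mul_add, ← mul_assoc, ← mul_assoc]
      exact add_mem (Ideal.mul_mem_right _ _ (mul_mem_symbPow (hBpow r) hA))
        (Ideal.mul_mem_right _ _ (mul_mem_symbPow (hBpow r) hA'))
    have hG : G = B ^ r * (B * u + (Q * A) * w + (Q * A') * w') + G'' * (Q * Q) := by
      linear_combination hG' + Q * hG''
    rw [hG, pow_succ]
    refine add_mem (Ideal.mul_mem_mul (Ideal.pow_mem_pow hB r) ?_)
      (Ideal.mul_mem_mul (ih hG''mem) (hmul hQ hQ))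
    exact add_mem (add_mem (Ideal.mul_mem_right _ _ hB) (Ideal.mul_mem_right _ _ (hmul hQ hA)))
      (Ideal.mul_mem_right _ _ (hmul hQ hA'))

theorem symbPow_two_mul_le {K ι : Type*} [Field K] [IsAlgClosed K] [Fintype ι]
    (hodd : Odd (Fintype.card ι)) {τ : Equiv.Perm ι} (hτ : ∀ i, τ i ≠ i)
    {Q : MvPolynomial (Fin 3) K} {P : ι → Fin 3 → K} (hP : ∀ i, P i ≠ 0)
    (hQ : ∀ i, Q ∈ homVanishingIdeal (P i)) (hQ2 : ∀ i, Q ∉ homVanishingIdeal (P i) ^ 2)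
    {α : MvPolynomial (Fin 3) K →ₐ[K] MvPolynomial (Fin 3) K} (hα : Function.Surjective α)
    (hker : ∀ G, conicHom K (α G) = 0 → Q ∣ G) {v : ι → Fin 2 → K} (hv : ∀ i, v i ≠ 0)
    (hvv : Pairwise fun i j => ¬ lineForm (v i) ∣ lineForm (v j))
    (hφ : ∀ i (c : K) (G), eval (c • v i) (conicHom K (α G)) = eval (c ^ 2 • P i) G) (r : ℕ) :
    symbPow P (2 * r) ≤ symbPow P 2 ^ r := by
  have := IsAlgClosed.instInfinite (K := K)
  have h2 : (0 : ZMod 2) = 1 + 1 := by decide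
  obtain ⟨φ, hφα⟩ : ∃ φ : MvPolynomial (Fin 3) K →ₐ[K] MvPolynomial (Fin 2) K,
      ∀ G, φ G = conicHom K (α G) := ⟨(conicHom K).comp α, fun _ => rfl⟩
  simp only [← hφα] at hker hφ
  have hlift {h : MvPolynomial (Fin 2) K}
      (hh : IsWeightedHomogeneous (fun _ => (1 : ZMod 2)) h 0) : ∃ G, φ G = h := by
    obtain ⟨u, rfl⟩ := exists_eq_conicHom_of_even hh
    obtain ⟨G, rfl⟩ := hα u
    exact ⟨G, hφα G⟩
  set f := ∏ i, lineForm (v i) with hf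
  have hf0 : f ≠ 0 := Finset.prod_ne_zero_iff.2 fun i _ => (irreducible_lineForm (hv i)).ne_zero
  have hf1 : IsWeightedHomogeneous (fun _ => (1 : ZMod 2)) f 1 := by
    have := IsWeightedHomogeneous.prod Finset.univ (fun i => lineForm (v i)) (fun _ => (1 : ZMod 2))
      fun i _ => isWeightedHomogeneous_lineForm (v i)
    simpa [(ZMod.natCast_eq_one_iff_odd).2 hodd] using this
  have hdvd (m : ℕ) (G) (hG : G ∈ symbPow P m) : f ^ m ∣ φ G :=
    prod_lineForm_pow_dvd hv hvv fun i => lineForm_pow_dvd (hv i) (hφ i) m (mem_symbPow.1 hG i)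
  have hcolon (m : ℕ) (G) (hG : Q * G ∈ symbPow P (m + 1)) : G ∈ symbPow P m :=
    mem_symbPow.2 fun i =>
      mem_homVanishingIdeal_pow_of_mul_mem (hP i) (hQ2 i) (mem_symbPow.1 hG i)
  have hmem {i : ι} {G} (hG : lineForm (v i) ∣ φ G) : G ∈ homVanishingIdeal (P i) :=
    mem_homVanishingIdeal_of_lineForm_dvd (hP i) (hφ i) hG
  obtain ⟨B, hB, hφB⟩ : ∃ B ∈ symbPow P 2, φ B = f ^ 2 := by
    have hL (i : ι) : ∃ L, φ L = lineForm (v i) * lineForm (v (τ i)) :=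
      hlift (h2 ▸ (isWeightedHomogeneous_lineForm _).mul (isWeightedHomogeneous_lineForm _))
    choose L hL using hL
    refine ⟨∏ i, L i, mem_symbPow.2 fun i => ?_, ?_⟩
    · classical
      have hne : i ≠ τ.symm i := fun h => hτ _ (by rw [τ.apply_symm_apply, ← h])
      have hd : L i * L (τ.symm i) ∣ ∏ i, L i := by
        rw [← Finset.prod_pair hne]
        exact Finset.prod_dvd_prod_of_subset _ _ _ (Finset.subset_univ _)
      refine Ideal.mem_of_dvd _ hd ?_
      rw [pow_two]
      refine Ideal.mul_mem_mul (hmem ?_) (hmem ?_)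
      · exact hL i ▸ dvd_mul_right _ _
      · rw [hL, τ.apply_symm_apply]
        exact dvd_mul_left _ _
    · rw [map_prod, Finset.prod_congr rfl fun i _ => hL i, Finset.prod_mul_distrib,
        Equiv.prod_comp τ fun i => lineForm (v i), pow_two]
  have hlin (k : Fin 2) : ∃ A ∈ symbPow P 1, φ A = f * X k := by
    obtain ⟨A, hA⟩ := hlift (h2 ▸ hf1.mul (isWeightedHomogeneous_X K _ k))
    refine ⟨A, mem_symbPow.2 fun i => ?_, hA⟩
    rw [pow_one]
    exact hmem (hA ▸ (Finset.dvd_prod_of_mem _ (Finset.mem_univ i)).mul_right _)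
  obtain ⟨A, hA, hφA⟩ := hlin 0
  obtain ⟨A', hA', hφA'⟩ := hlin 1
  have hQ1 : Q ∈ symbPow P 1 := mem_symbPow.2 fun i => by rw [pow_one]; exact hQ i
  exact symbPow_two_mul_le_of_lifts hQ1 hcolon hα hφα hker hf0 hf1 hdvd hA hφA hA' hφA' hB hφB r

/-- For the radical ideal of an odd number `n ≥ 5` of distinct points on a
smooth plane conic, `I^{(mr)} = (I^{(m)})^r` for every even `m ≥ 2` and every `r ≥ 1`. -/
theorem stmt6 {K : Type*} [Field K] [IsAlgClosed K]
    {n : ℕ} (hn : 5 ≤ n) (hodd : Odd n)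
    (Q : MvPolynomial (Fin 3) K) (hQdeg : Q.IsHomogeneous 2) (hQ0 : Q ≠ 0)
    (hsm : ∀ p : Fin 3 → K, p ≠ 0 → MvPolynomial.eval p Q = 0 →
      ∃ i, MvPolynomial.eval p (MvPolynomial.pderiv i Q) ≠ 0)
    (P : Fin n → (Fin 3 → K)) (hP : ProjectivelyDistinct P)
    (honC : ∀ i, MvPolynomial.eval (P i) Q = 0)
    (m r : ℕ) (hme : Even m) (hm : 2 ≤ m) (hr : 1 ≤ r) :
    symbPow P (m * r) = symbPow P m ^ r := by
  have := IsAlgClosed.instInfinite (K := K)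
  obtain ⟨hP0, hPP⟩ := hP
  obtain ⟨M, hM, hMQ⟩ := exists_linSubst_eq_neg hQdeg hsm (hP0 ⟨0, by lia⟩) (honC _)
  have hM1 := M.mul_nonsing_inv hM
  have hM2 := M.nonsing_inv_mul hM
  have hv (i : Fin n) : ∃ v : Fin 2 → K, M⁻¹.mulVec (P i) = ![v 0 * v 1, v 0 ^ 2, v 1 ^ 2] := by
    refine exists_conic_param ?_
    have h := eval_linSubst M (M⁻¹.mulVec (P i)) Q
    rw [Matrix.mulVec_mulVec, hM1, Matrix.one_mulVec, honC, hMQ] at h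
    simp only [map_neg, map_sub, map_mul, map_pow, eval_X] at h
    linear_combination -h
  choose v hv using hv
  have hPv (i : Fin n) : P i = M.mulVec ![v i 0 * v i 1, v i 0 ^ 2, v i 1 ^ 2] := by
    rw [← hv, Matrix.mulVec_mulVec, hM1, Matrix.one_mulVec]
  have hφ (i : Fin n) (c : K) (G : MvPolynomial (Fin 3) K) :
      eval (c • v i) (conicHom K (linSubst M G)) = eval (c ^ 2 • P i) G := by
    rw [eval_conicHom, eval_linSubst, hPv, ← Matrix.mulVec_smul]
    congr 3
    ext j
    fin_cases j <;> simp <;> ring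
  have hv0 (i : Fin n) : v i ≠ 0 := by
    intro h
    apply hP0 i
    rw [hPv, h]
    convert M.mulVec_zero
    ext j
    fin_cases j <;> simp
  have hvv : Pairwise fun i j => ¬ lineForm (v i) ∣ lineForm (v j) := by
    rintro i j hij ⟨h, hh⟩
    have he : v j 1 * v i 0 = v j 0 * v i 1 := by
      have := congrArg (eval (v i)) hh
      simp [lineForm] at this
      linear_combination this
    obtain ⟨k, hk⟩ := Function.ne_iff.1 (hv0 j)
    rw [Pi.zero_apply] at hk
    have hc : v i = (v i k / v j k) • v j := by
      ext l
      rw [Pi.smul_apply, smul_eq_mul, div_mul_eq_mul_div, eq_div_iff hk]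
      fin_cases k <;> fin_cases l
      · rfl
      · simp; linear_combination -he
      · simp; linear_combination he
      · rfl
    generalize v i k / v j k = c at hc
    apply hPP hij (c ^ 2)
    rw [hPv i, hPv j, ← Matrix.mulVec_smul, hc]
    congr 1
    ext l
    fin_cases l <;> simp <;> ring
  have hker (G : MvPolynomial (Fin 3) K) (hG : conicHom K (linSubst M G) = 0) : Q ∣ G := by
    have h := dvd_of_conicHom_eq_zero hG
    rw [← neg_dvd, ← hMQ] at h
    simpa only [linSubst_linSubst hM1] using map_dvd (linSubst M⁻¹) h
  have hle := symbPow_two_mul_le (by simpa using hodd) (τ := finRotate n) ?_ hP0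
    (fun i => Ideal.subset_span ⟨⟨2, hQdeg⟩, honC i⟩) ?_
    (fun G => ⟨linSubst M⁻¹ G, linSubst_linSubst hM2 G⟩) hker hv0 hvv hφ
  · have heq (r : ℕ) : symbPow P (2 * r) = symbPow P 2 ^ r :=
      le_antisymm (hle r) (symbPow_pow_le P 2 r)
    obtain ⟨s, rfl⟩ := hme.two_dvd
    rw [mul_assoc, heq, heq, pow_mul]
  · intro i
    obtain ⟨k, rfl⟩ : ∃ k, n = k + 2 := ⟨n - 2, by lia⟩
    rw [finRotate_apply]
    simp
  · intro i hi
    obtain ⟨j, hj⟩ := hsm (P i) (hP0 i) (honC i)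
    exact hj (eval_pderiv_eq_zero_of_mem_sq hi j)
end
end

section
/- Let I ⊆ K[x_0, x_1, x_2] be the radical ideal of n ≥ 5 distinct points lying on a smooth conic C in P^2, where n is odd. Then I^{(2r+1)} = (I^{(2)})^r · I for every integer r ≥ 0. -/
open MvPolynomial

noncomputable section

section Ideals

variable {R : Type*} [CommRing R]

/-- Two primes `p`, `q` containing `Q` together with coordinates `L`, `u`, `v` behaving like two
points on a plane conic `Q`: `L` cuts out the secant line through the points, and `u`, `v` are
further lines through `q`, respectively `p`. -/
structure IsSecant (p q : Ideal R) (Q L u v : R) : Prop where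
  left_eq : p = Ideal.span {v, L}
  right_eq : q = Ideal.span {u, L}
  left_prime : p.IsPrime
  right_prime : q.IsPrime
  left_notMem : u ∉ p
  right_notMem : v ∉ q
  mul_mem : u * v ∈ Ideal.span {L, Q}
  inf_le : p ⊓ q ≤ Ideal.span {L, Q}
  regular : ∀ F, L * F ∈ Ideal.span {Q} → F ∈ Ideal.span {Q}
  cancel : ∀ m F, Q * F ∈ p ^ (m + 1) → F ∈ p ^ m

/-- `F` vanishes to order at least `m` at the prime `p`, as a function on the locus `Q = 0`. -/
def VanishesOn (p : Ideal R) (Q : R) (m : ℕ) (F : R) : Prop :=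
  ∃ h, h ∉ p ∧ h * F ∈ p ^ m ⊔ Ideal.span {Q}

namespace VanishesOn

variable {p : Ideal R} {Q F G : R} {m : ℕ}

lemma of_mem_pow [hp : p.IsPrime] (hF : F ∈ p ^ m) : VanishesOn p Q m F :=
  ⟨1, p.ne_top_iff_one.mp hp.ne_top, by simpa using Ideal.mem_sup_left hF⟩

lemma congr (hF : VanishesOn p Q m F) (h : F - G ∈ Ideal.span {Q}) : VanishesOn p Q m G := by
  obtain ⟨w, hw, hwF⟩ := hF
  refine ⟨w, hw, ?_⟩
  have : w * G = w * F - w * (F - G) := by ring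
  rw [this]
  exact sub_mem hwF (Ideal.mem_sup_right (Ideal.mul_mem_left _ _ h))

lemma of_mul [hp : p.IsPrime] {l : R} (hl : l ∉ p) (h : VanishesOn p Q m (l * F)) :
    VanishesOn p Q m F := by
  obtain ⟨w, hw, hwF⟩ := h
  exact ⟨w * l, fun h => (hp.mem_or_mem h).elim hw hl, by rwa [mul_assoc]⟩

lemma mem [hp : p.IsPrime] (hQ : Q ∈ p) (hm : m ≠ 0) (h : VanishesOn p Q m F) : F ∈ p := by
  obtain ⟨w, hw, hwF⟩ := h
  have hle : p ^ m ⊔ Ideal.span {Q} ≤ p :=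
    sup_le (Ideal.pow_le_self hm) ((Ideal.span_singleton_le_iff_mem _).mpr hQ)
  exact (hp.mem_or_mem (hle hwF)).resolve_left hw

end VanishesOn

lemma sup_pow_le_pow_sup (A B : Ideal R) (k : ℕ) : (A ⊔ B) ^ k ≤ A ^ k ⊔ B := by
  induction k with
  | zero => simp
  | succ k ih =>
    calc (A ⊔ B) ^ (k + 1) = (A ⊔ B) ^ k * (A ⊔ B) := pow_succ _ _
      _ ≤ (A ^ k ⊔ B) * (A ⊔ B) := Ideal.mul_mono_left ih
      _ = (A ^ k * A ⊔ B * A) ⊔ (A ^ k ⊔ B) * B := by rw [Ideal.mul_sup, Ideal.sup_mul]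
      _ ≤ A ^ (k + 1) ⊔ B := ?_
    rw [← pow_succ]
    exact sup_le (sup_le le_sup_left (Ideal.mul_le_left.trans le_sup_right))
      (Ideal.mul_le_right.trans le_sup_right)

/-- If a prime `p` containing `L` is locally generated by `L` modulo `Q`, dividing by `L` lowers
the order of vanishing at `p` by one. -/
lemma VanishesOn.of_uniformizer_mul {p : Ideal R} [hp : p.IsPrime] {Q L u F : R} {m : ℕ}
    (hL : L ∈ p) (hu : u ∉ p) (hup : Ideal.span {u} * p ≤ Ideal.span {L} ⊔ Ideal.span {Q})
    (hreg : ∀ F, L * F ∈ Ideal.span {Q} → F ∈ Ideal.span {Q})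
    (h : VanishesOn p Q (m + 1) (L * F)) : VanishesOn p Q m F := by
  obtain ⟨w, hw, hwF⟩ := h
  refine ⟨u ^ (m + 1) * w, fun h => (hp.mem_or_mem h).elim
    (fun h => hu (hp.mem_of_pow_mem _ h)) hw, ?_⟩
  have key : u ^ (m + 1) * (w * (L * F)) ∈ Ideal.span {L ^ (m + 1)} ⊔ Ideal.span {Q} := by
    have h1 : Ideal.span {u ^ (m + 1)} * (p ^ (m + 1) ⊔ Ideal.span {Q}) ≤
        Ideal.span {L ^ (m + 1)} ⊔ Ideal.span {Q} := by
      rw [Ideal.mul_sup, ← Ideal.span_singleton_pow, ← Ideal.span_singleton_pow, ← mul_pow]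
      exact sup_le ((Ideal.pow_right_mono hup _).trans (sup_pow_le_pow_sup _ _ _))
        (Ideal.mul_le_right.trans le_sup_right)
    exact h1 (Ideal.mul_mem_mul (Ideal.mem_span_singleton_self _) hwF)
  obtain ⟨a, b, hb, hab⟩ := Ideal.mem_span_singleton_sup.mp key
  have h2 : u ^ (m + 1) * w * F - a * L ^ m ∈ Ideal.span {Q} := by
    apply hreg
    have : L * (u ^ (m + 1) * w * F - a * L ^ m) = b := by
      linear_combination -hab
    rwa [this]
  rw [← sub_add_cancel (u ^ (m + 1) * w * F) (a * L ^ m)]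
  exact add_mem (Ideal.mem_sup_right h2)
    (Ideal.mem_sup_left (Ideal.mul_mem_left _ _ (Ideal.pow_mem_pow hL m)))

namespace IsSecant

variable {p q : Ideal R} {Q L u v : R}

lemma mem_left (h : IsSecant p q Q L u v) : L ∈ p := by
  rw [h.left_eq]; exact Ideal.subset_span (by simp)

lemma mem_right (h : IsSecant p q Q L u v) : L ∈ q := by
  rw [h.right_eq]; exact Ideal.subset_span (by simp)

lemma vanishesOn_left (h : IsSecant p q Q L u v) {m : ℕ} {F : R}
    (hF : VanishesOn p Q (m + 1) (L * F)) : VanishesOn p Q m F := by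
  have := h.left_prime
  refine hF.of_uniformizer_mul h.mem_left h.left_notMem ?_ h.regular
  rw [← Ideal.span_insert, Ideal.span_singleton_mul_le_iff, h.left_eq]
  intro z hz
  obtain ⟨a, b, rfl⟩ := Ideal.mem_span_pair.mp hz
  have : u * (a * v + b * L) = a * (u * v) + u * b * L := by ring
  rw [this]
  exact add_mem (Ideal.mul_mem_left _ _ h.mul_mem)
    (Ideal.mul_mem_left _ _ (Ideal.subset_span (by simp)))

lemma vanishesOn_right (h : IsSecant p q Q L u v) {m : ℕ} {F : R}
    (hF : VanishesOn q Q (m + 1) (L * F)) : VanishesOn q Q m F := by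
  have := h.right_prime
  refine hF.of_uniformizer_mul h.mem_right h.right_notMem ?_ h.regular
  rw [← Ideal.span_insert, Ideal.span_singleton_mul_le_iff, h.right_eq]
  intro z hz
  obtain ⟨a, b, rfl⟩ := Ideal.mem_span_pair.mp hz
  have : v * (a * u + b * L) = a * (u * v) + v * b * L := by ring
  rw [this]
  exact add_mem (Ideal.mul_mem_left _ _ h.mul_mem)
    (Ideal.mul_mem_left _ _ (Ideal.subset_span (by simp)))

/-- The secant line meets the conic in no further point. -/
lemma le_or_le_of_mem (h : IsSecant p q Q L u v) {P : Ideal R} [hP : P.IsPrime]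
    (hQ : Q ∈ P) (hL : L ∈ P) : p ≤ P ∨ q ≤ P := by
  have huv : u * v ∈ P := by
    have : Ideal.span {L, Q} ≤ P := Ideal.span_le.mpr (by rintro x (rfl | rfl) <;> assumption)
    exact this h.mul_mem
  rw [h.left_eq, h.right_eq]
  rcases hP.mem_or_mem huv with hu | hv
  · exact Or.inr (Ideal.span_le.mpr (by rintro x (rfl | rfl) <;> assumption))
  · exact Or.inl (Ideal.span_le.mpr (by rintro x (rfl | rfl) <;> assumption))

end IsSecant

section Polygon

variable {ι : Type*} [DecidableEq ι] {p : ι → Ideal R} {Q : R} {σ : Equiv.Perm ι}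
  {L u v : ι → R}

lemma prod_secants_mem_pow (h : ∀ i, IsSecant (p i) (p (σ i)) Q (L i) (u i) (v i))
    (s : Multiset ι) (k : ι) :
    (s.map L).prod ∈ p k ^ s.countP (fun a => k = a ∨ k = σ a) := by
  induction s using Multiset.induction with
  | empty => simp
  | cons i s ih =>
    rw [Multiset.map_cons, Multiset.prod_cons]
    by_cases hk : k = i ∨ k = σ i
    · rw [Multiset.countP_cons_of_pos (p := fun a => k = a ∨ k = σ a) _ hk, pow_succ']
      refine Ideal.mul_mem_mul ?_ ih
      rcases hk with rfl | rfl
      · exact (h k).mem_left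
      · exact (h i).mem_right
    · rw [Multiset.countP_cons_of_neg (p := fun a => k = a ∨ k = σ a) _ hk]
      exact Ideal.mul_mem_left _ _ ih

lemma exists_sub_prod_secants_mul_mem
    (h : ∀ i, IsSecant (p i) (p (σ i)) Q (L i) (u i) (v i))
    (hQ : ∀ i, Q ∈ p i) (hp : ∀ i j, p i ≤ p j → i = j) (e : ℕ) (s : Multiset ι) :
    ∀ F, (∀ k, VanishesOn (p k) Q (s.countP (fun a => k = a ∨ k = σ a) + e) F) →
      ∃ a, (∀ k, VanishesOn (p k) Q e a) ∧ F - (s.map L).prod * a ∈ Ideal.span {Q} := by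
  have hprime : ∀ i, (p i).IsPrime := fun i => (h i).left_prime
  induction s using Multiset.induction with
  | empty => exact fun F hF => ⟨F, by simpa using hF, by simp⟩
  | cons i s ih =>
    intro F hF
    have hmem : ∀ k, (k = i ∨ k = σ i) → F ∈ p k := fun k hk =>
      (hF k).mem (hQ k) (by
        rw [Multiset.countP_cons_of_pos (p := fun a => k = a ∨ k = σ a) _ hk]
        omega)
    obtain ⟨x, y, hxy⟩ := Ideal.mem_span_pair.mp
      ((h i).inf_le ⟨hmem i (Or.inl rfl), hmem (σ i) (Or.inr rfl)⟩)
    have hFx : F - L i * x ∈ Ideal.span {Q} :=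
      Ideal.mem_span_singleton'.mpr ⟨y, by linear_combination hxy⟩
    obtain ⟨a, ha, hax⟩ := ih x fun k => by
      have hk := (hF k).congr hFx
      by_cases hki : k = i ∨ k = σ i
      · rw [Multiset.countP_cons_of_pos (p := fun a => k = a ∨ k = σ a) _ hki, add_right_comm] at hk
        rcases hki with rfl | rfl
        · exact (h k).vanishesOn_left hk
        · exact (h i).vanishesOn_right hk
      · rw [Multiset.countP_cons_of_neg (p := fun a => k = a ∨ k = σ a) _ hki] at hk
        refine hk.of_mul fun hL => hki ?_
        rcases (h i).le_or_le_of_mem (hQ k) hL with hle | hle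
        · exact Or.inl (hp _ _ hle).symm
        · exact Or.inr (hp _ _ hle).symm
    refine ⟨a, ha, ?_⟩
    rw [Multiset.map_cons, Multiset.prod_cons]
    have : F - L i * (s.map L).prod * a = (F - L i * x) + L i * (x - (s.map L).prod * a) := by
      ring
    rw [this]
    exact add_mem hFx (Ideal.mul_mem_left _ _ hax)

lemma countP_incidence_univ [Fintype ι] (hσ : ∀ i, σ i ≠ i) (k : ι) :
    (Finset.univ : Finset ι).val.countP (fun a => k = a ∨ k = σ a) = 2 := by
  rw [Multiset.countP_eq_card_filter, ← Finset.filter_val, Finset.card_val]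
  have : Finset.univ.filter (fun a => k = a ∨ k = σ a) = {k, σ.symm k} := by
    ext a
    simp only [Finset.mem_filter, Finset.mem_univ, true_and, Finset.mem_insert,
      Finset.mem_singleton, Equiv.eq_symm_apply]
    exact or_congr eq_comm eq_comm
  rw [this, Finset.card_pair]
  intro hk
  exact hσ k (by rw [← Equiv.eq_symm_apply]; exact hk)

variable [Fintype ι]

lemma exists_eq_prod_pow_mul_add
    (h : ∀ i, IsSecant (p i) (p (σ i)) Q (L i) (u i) (v i)) (hσ : ∀ i, σ i ≠ i)
    (hQ : ∀ i, Q ∈ p i) (hp : ∀ i j, p i ≤ p j → i = j) {r e m : ℕ} (he : e ≤ 1)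
    (hm : 2 * r + e = m + 1) {F : R} (hF : ∀ i, F ∈ p i ^ (m + 1)) :
    ∃ a b, (∀ i, a ∈ p i ^ e) ∧ (∀ i, b ∈ p i ^ m) ∧ F = (∏ i, L i) ^ r * a + Q * b := by
  have hprime : ∀ i, (p i).IsPrime := fun i => (h i).left_prime
  have hcount : ∀ k, (r • (Finset.univ : Finset ι).val).countP (fun a => k = a ∨ k = σ a) =
      2 * r := fun k => by
    rw [Multiset.countP_nsmul, countP_incidence_univ hσ, mul_comm]
  have hprod : ((r • (Finset.univ : Finset ι).val).map L).prod = (∏ i, L i) ^ r := by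
    rw [Multiset.map_nsmul, Multiset.prod_nsmul]
    rfl
  obtain ⟨a, ha, hFa⟩ := exists_sub_prod_secants_mul_mem h hQ hp e
    (r • (Finset.univ : Finset ι).val) F fun k => by
      rw [hcount, hm]
      exact .of_mem_pow (hF k)
  rw [hprod] at hFa
  obtain ⟨b, hb⟩ := Ideal.mem_span_singleton'.mp hFa
  have hae : ∀ i, a ∈ p i ^ e := fun i => by
    obtain rfl | rfl : e = 0 ∨ e = 1 := by omega
    · simp
    · simpa using (ha i).mem (hQ i) one_ne_zero
  refine ⟨a, b, hae, fun i => (h i).cancel m b ?_, by linear_combination -hb⟩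
  have hG : (∏ i, L i) ^ r ∈ p i ^ (2 * r) := by
    rw [← hprod, ← hcount i]
    exact prod_secants_mem_pow h _ i
  have : Q * b = F - (∏ i, L i) ^ r * a := by linear_combination hb
  rw [this]
  refine sub_mem (hF i) ?_
  rw [← hm, pow_add]
  exact Ideal.mul_mem_mul hG (hae i)

/-- For primes arranged cyclically as the vertices of a polygon inscribed in a conic, the odd
symbolic powers of their intersection are generated by the second and the first one. -/
theorem iInf_pow_odd_eq
    (h : ∀ i, IsSecant (p i) (p (σ i)) Q (L i) (u i) (v i)) (hσ : ∀ i, σ i ≠ i)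
    (hQ : ∀ i, Q ∈ p i) (hp : ∀ i j, p i ≤ p j → i = j) (r : ℕ) :
    ⨅ i, p i ^ (2 * r + 1) = (⨅ i, p i ^ 2) ^ r * ⨅ i, p i ^ 1 := by
  apply le_antisymm
  · induction r with
    | zero => simp
    | succ r ih =>
      intro F hF
      rw [Ideal.mem_iInf] at hF
      obtain ⟨a, b, ha, hb, rfl⟩ := exists_eq_prod_pow_mul_add h hσ hQ hp (r := r + 1)
        (e := 1) (m := 2 * (r + 1)) le_rfl rfl hF
      obtain ⟨a', b', -, hb', rfl⟩ := exists_eq_prod_pow_mul_add h hσ hQ hp (r := r + 1)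
        (e := 0) (m := 2 * r + 1) zero_le_one rfl hb
      have hG : ∏ i, L i ∈ ⨅ i, p i ^ 2 := by
        rw [Ideal.mem_iInf]
        intro i
        have := prod_secants_mem_pow h (Finset.univ : Finset ι).val i
        rwa [countP_incidence_univ hσ] at this
      have hQ2 : Q ^ 2 ∈ ⨅ i, p i ^ 2 := by
        rw [Ideal.mem_iInf]
        exact fun i => Ideal.pow_mem_pow (hQ i) 2
      have h1 : a + Q * a' ∈ ⨅ i, p i ^ 1 := by
        rw [Ideal.mem_iInf]
        exact fun i => add_mem (ha i) (Ideal.mul_mem_right _ _ (by simpa using hQ i))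
      have h2 := Ideal.mul_mem_mul hQ2 (ih ((Ideal.mem_iInf).mpr hb'))
      rw [← mul_assoc, ← pow_succ'] at h2
      have : (∏ i, L i) ^ (r + 1) * a + Q * ((∏ i, L i) ^ (r + 1) * a' + Q * b') =
          (∏ i, L i) ^ (r + 1) * (a + Q * a') + Q ^ 2 * b' := by ring
      rw [this]
      exact add_mem (Ideal.mul_mem_mul (Ideal.pow_mem_pow hG _) h1) h2
  · refine le_iInf fun i => ?_
    rw [pow_add, pow_mul]
    exact Ideal.mul_mono (Ideal.pow_right_mono (iInf_le _ i) r) (iInf_le _ i)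

end Polygon

end Ideals

section Coordinates

variable {K σ : Type*} [Field K]

lemma aeval_C_mul_X_of_isHomogeneous (p : σ → K) {F : MvPolynomial σ K} {d : ℕ}
    (hF : F.IsHomogeneous d) :
    aeval (fun i => Polynomial.C (p i) * Polynomial.X) F =
      Polynomial.C (eval p F) * Polynomial.X ^ d := by
  rw [aeval_def, eval₂_eq, eval_eq, map_sum, Finset.sum_mul]
  refine Finset.sum_congr rfl fun m hm => ?_
  have hmd : ∑ i ∈ m.support, m i = d := by
    rw [← Finsupp.degree_apply]
    by_contra h
    exact mem_support_iff.mp hm (hF.coeff_eq_zero h)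
  simp_rw [mul_pow, Finset.prod_mul_distrib, Finset.prod_pow_eq_pow_sum, hmd]
  simp [mul_assoc]

/-- The vanishing ideal of a point is the kernel of restriction to the line through it. -/
lemma homVanishingIdeal_eq_ker (p : σ → K) :
    homVanishingIdeal p = RingHom.ker
      (aeval (fun i => Polynomial.C (p i) * Polynomial.X) :
        MvPolynomial σ K →ₐ[K] Polynomial K) := by
  apply le_antisymm
  · refine Ideal.span_le.mpr ?_
    rintro F ⟨⟨d, hd⟩, hF⟩
    simp [RingHom.mem_ker, aeval_C_mul_X_of_isHomogeneous p hd, hF]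
  · intro F hF
    rw [RingHom.mem_ker, ← sum_homogeneousComponent F, map_sum] at hF
    simp_rw [aeval_C_mul_X_of_isHomogeneous p (homogeneousComponent_isHomogeneous _ F)] at hF
    rw [← sum_homogeneousComponent F]
    refine sum_mem fun d hd => Ideal.subset_span
      ⟨⟨d, homogeneousComponent_isHomogeneous d F⟩, ?_⟩
    have := congrArg (fun f => Polynomial.coeff f d) hF
    simpa [Polynomial.finsetSum_coeff, Polynomial.coeff_C_mul, Polynomial.coeff_X_pow,
      Finset.mem_range.mp hd] using this

instance homVanishingIdeal_isPrime (p : σ → K) : (homVanishingIdeal p).IsPrime := by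
  rw [homVanishingIdeal_eq_ker]
  exact RingHom.ker_isPrime _

lemma mem_homVanishingIdeal_iff_s7 {p : σ → K} {F : MvPolynomial σ K} {d : ℕ}
    (hF : F.IsHomogeneous d) : F ∈ homVanishingIdeal p ↔ eval p F = 0 := by
  rw [homVanishingIdeal_eq_ker, RingHom.mem_ker, aeval_C_mul_X_of_isHomogeneous p hF]
  simp

lemma mul_eq_mul_of_homVanishingIdeal_le {p q : σ → K}
    (h : homVanishingIdeal p ≤ homVanishingIdeal q) (i j : σ) : p i * q j = p j * q i := by
  have hd : (C (p i) * X j - C (p j) * X i : MvPolynomial σ K).IsHomogeneous 1 :=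
    (isHomogeneous_C_mul_X _ _).sub (isHomogeneous_C_mul_X _ _)
  have hmem := (mem_homVanishingIdeal_iff_s7 (p := p) hd).mpr (by simp [mul_comm])
  have := (mem_homVanishingIdeal_iff_s7 hd).mp (h hmem)
  simpa [sub_eq_zero] using this

lemma exists_eq_smul_of_mul_eq_mul {p q : σ → K} (hp : p ≠ 0)
    (h : ∀ i j, p i * q j = p j * q i) : ∃ c : K, q = c • p := by
  obtain ⟨i, hi⟩ := Function.ne_iff.mp hp
  refine ⟨q i / p i, funext fun j => ?_⟩
  have hi' : p i ≠ 0 := hi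
  simp only [Pi.smul_apply, smul_eq_mul]
  field_simp
  linear_combination h i j

lemma mem_homVanishingIdeal_single_iff [DecidableEq σ] (k : σ) (F : MvPolynomial σ K) :
    F ∈ homVanishingIdeal (Pi.single k 1 : σ → K) ↔
      F ∈ Ideal.span (X '' {i | i ≠ k} : Set (MvPolynomial σ K)) := by
  revert F
  rw [← SetLike.ext_iff]
  apply le_antisymm
  · refine Ideal.span_le.mpr ?_
    rintro F ⟨⟨d, hd⟩, hF⟩
    refine mem_ideal_span_X_image.mpr fun m hm => ?_
    have hsingle : ∀ m' ∈ F.support, (∀ i, i ≠ k → m' i = 0) → m' = Finsupp.single k d := by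
      intro m' hm' h
      have hmk : m' = Finsupp.single k (m' k) := by
        ext i
        by_cases hi : i = k
        · simp [hi]
        · rw [Finsupp.single_eq_of_ne hi]
          exact h i hi
      have hmd := hd (mem_support_iff.mp hm')
      rw [hmk] at hmd
      rw [hmk, show m' k = d by simpa [Finsupp.weight_apply] using hmd]
    by_contra! h
    obtain rfl := hsingle m hm h
    rw [eval_eq, Finset.sum_eq_single (Finsupp.single k d)] at hF
    · refine mem_support_iff.mp hm ((mul_eq_zero.mp hF).resolve_right
        (Finset.prod_ne_zero_iff.mpr fun i hi => ?_))
      obtain rfl : i = k := by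
        by_contra hik
        simp [Finsupp.single_eq_of_ne hik] at hi
      simp
    · intro m' hm' hne
      obtain ⟨i, hik, hi⟩ : ∃ i, i ≠ k ∧ m' i ≠ 0 := by
        by_contra! h'
        exact hne (hsingle m' hm' h')
      rw [Finset.prod_eq_zero (Finsupp.mem_support_iff.mpr hi), mul_zero]
      rw [Pi.single_eq_of_ne hik, zero_pow hi]
    · exact fun h => (h hm).elim
  · refine Ideal.span_le.mpr ?_
    rintro _ ⟨i, hi, rfl⟩
    exact (mem_homVanishingIdeal_iff_s7 (isHomogeneous_X K i)).mpr (by simp [Pi.single_eq_of_ne hi])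

/-- The linear substitution of coordinates given by a square matrix. -/
def linearSubst [Fintype σ] (B : Matrix σ σ K) : MvPolynomial σ K →ₐ[K] MvPolynomial σ K :=
  aeval fun i => ∑ k, C (B i k) * X k

section LinearSubst

variable [Fintype σ]

lemma linearSubst_one [DecidableEq σ] : linearSubst (1 : Matrix σ σ K) = AlgHom.id K _ := by
  ext1 i
  simp [linearSubst, Matrix.one_apply]

lemma linearSubst_comp (A B : Matrix σ σ K) :
    (linearSubst B).comp (linearSubst A) = linearSubst (A * B) := by
  ext1 i
  simp only [linearSubst, AlgHom.comp_apply, aeval_X, map_sum, map_mul, Matrix.mul_apply,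
    Finset.sum_mul, ← algebraMap_eq, AlgHom.commutes, Finset.mul_sum, mul_assoc]
  exact Finset.sum_comm

lemma eval_linearSubst (B : Matrix σ σ K) (y : σ → K) (F : MvPolynomial σ K) :
    eval y (linearSubst B F) = eval (B.mulVec y) F := by
  induction F using MvPolynomial.induction_on with
  | C a => simp [linearSubst]
  | add p q hp hq => simp only [map_add, hp, hq]
  | mul_X p i hp =>
    simp only [map_mul, hp]
    simp [linearSubst, Matrix.mulVec, dotProduct]

lemma isHomogeneous_linearSubst (B : Matrix σ σ K) {F : MvPolynomial σ K} {d : ℕ}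
    (hF : F.IsHomogeneous d) : (linearSubst B F).IsHomogeneous d := by
  have := hF.aeval (n := 1) (fun i => ∑ k, C (B i k) * X k : σ → MvPolynomial σ K)
    fun i => IsHomogeneous.sum _ _ _ fun k _ => isHomogeneous_C_mul_X _ _
  simpa [linearSubst] using this

lemma linearSubst_mem {B : Matrix σ σ K} {y : σ → K} {F : MvPolynomial σ K}
    (hF : F ∈ homVanishingIdeal (B.mulVec y)) : linearSubst B F ∈ homVanishingIdeal y := by
  suffices homVanishingIdeal (B.mulVec y) ≤ (homVanishingIdeal y).comap (linearSubst B) from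
    this hF
  refine Ideal.span_le.mpr ?_
  rintro F ⟨⟨d, hd⟩, hF⟩
  exact Ideal.subset_span ⟨⟨d, isHomogeneous_linearSubst B hd⟩, by rw [eval_linearSubst, hF]⟩

variable [DecidableEq σ]

/-- An invertible linear substitution, as an automorphism of the polynomial ring. -/
def linearSubstEquiv (B : (Matrix σ σ K)ˣ) : MvPolynomial σ K ≃ₐ[K] MvPolynomial σ K :=
  AlgEquiv.ofAlgHom (linearSubst (B : Matrix σ σ K)) (linearSubst (↑B⁻¹ : Matrix σ σ K))
    (by rw [linearSubst_comp, Units.inv_mul, linearSubst_one])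
    (by rw [linearSubst_comp, Units.mul_inv, linearSubst_one])

lemma map_linearSubstEquiv_symm (B : (Matrix σ σ K)ˣ) (y : σ → K) :
    (homVanishingIdeal y).map (linearSubstEquiv B).symm =
      homVanishingIdeal ((B : Matrix σ σ K).mulVec y) := by
  apply le_antisymm
  · refine Ideal.map_le_iff_le_comap.mpr fun F hF => ?_
    refine linearSubst_mem (B := (↑B⁻¹ : Matrix σ σ K)) ?_
    rwa [Matrix.mulVec_mulVec, Units.inv_mul, Matrix.one_mulVec]
  · intro F hF
    rw [← (linearSubstEquiv B).symm_apply_apply F]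
    exact Ideal.mem_map_of_mem _ (linearSubst_mem hF)

end LinearSubst

/-- The substitution scaling the first two coordinates by a new variable. -/
def scaleSubst (K : Type*) [Field K] :
    MvPolynomial (Fin 3) K →ₐ[K] Polynomial (MvPolynomial (Fin 3) K) :=
  aeval ![Polynomial.C (X 0) * Polynomial.X, Polynomial.C (X 1) * Polynomial.X,
    Polynomial.C (X 2)]

lemma scaleSubst_monomial (s : Fin 3 →₀ ℕ) (a : K) :
    scaleSubst K (monomial s a) = Polynomial.C (monomial s a) * Polynomial.X ^ (s 0 + s 1) := by
  rw [scaleSubst, aeval_monomial, monomial_eq, Finsupp.prod_fintype _ _ (by simp),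
    Finsupp.prod_fintype _ _ (by simp)]
  simp only [Fin.prod_univ_three, map_mul, map_pow, Matrix.cons_val_zero, Matrix.cons_val_one,
    Matrix.cons_val]
  rw [IsScalarTower.algebraMap_apply K (MvPolynomial (Fin 3) K) (Polynomial _)]
  simp only [algebraMap_eq, Polynomial.algebraMap_eq]
  ring

lemma coeff_scaleSubst (F : MvPolynomial (Fin 3) K) (d : Fin 3 →₀ ℕ) :
    coeff d ((scaleSubst K F).coeff (d 0 + d 1)) = coeff d F := by
  classical
  induction F using MvPolynomial.induction_on' with
  | monomial s a =>
    rw [scaleSubst_monomial, Polynomial.coeff_C_mul, Polynomial.coeff_X_pow]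
    by_cases h : s = d
    · simp [h]
    · split_ifs <;> simp [coeff_monomial, h]
  | add p q hp hq => simp only [map_add, Polynomial.coeff_add, coeff_add, hp, hq]

lemma mem_span_pow_iff_X_pow_dvd_scaleSubst (F : MvPolynomial (Fin 3) K) (m : ℕ) :
    F ∈ Ideal.span {X 0, X 1} ^ m ↔ Polynomial.X ^ m ∣ scaleSubst K F := by
  constructor
  · intro hF
    rw [← Ideal.mem_span_singleton, ← Ideal.span_singleton_pow]
    have : Ideal.span {X 0, X 1} ≤ (Ideal.span {Polynomial.X}).comap (scaleSubst K) := by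
      refine Ideal.span_le.mpr ?_
      rintro x (rfl | rfl) <;>
        simp [scaleSubst, Ideal.mem_span_singleton]
    exact Ideal.le_comap_pow _ _ (Ideal.pow_right_mono this m hF)
  · intro hF
    rw [Polynomial.X_pow_dvd_iff] at hF
    rw [← support_sum_monomial_coeff F]
    refine sum_mem fun d hd => ?_
    have hdm : m ≤ d 0 + d 1 := by
      by_contra! h
      refine mem_support_iff.mp hd ?_
      rw [← coeff_scaleSubst, hF _ h, coeff_zero]
    rw [monomial_eq, Finsupp.prod_fintype _ _ (by simp), Fin.prod_univ_three]
    refine Ideal.mul_mem_left _ _ (Ideal.mul_mem_right _ _ (Ideal.pow_le_pow_right hdm ?_))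
    rw [pow_add]
    exact Ideal.mul_mem_mul (Ideal.pow_mem_pow (Ideal.subset_span (by simp)) _)
      (Ideal.pow_mem_pow (Ideal.subset_span (by simp)) _)

lemma mem_span_pow_of_mul_mem {Q F : MvPolynomial (Fin 3) K} {m : ℕ}
    (hQ : Q ∉ Ideal.span {X 0, X 1} ^ 2) (h : Q * F ∈ Ideal.span {X 0, X 1} ^ (m + 1)) :
    F ∈ Ideal.span {X 0, X 1} ^ m := by
  rw [mem_span_pow_iff_X_pow_dvd_scaleSubst] at *
  rw [map_mul] at h
  have hX : Prime (Polynomial.X : Polynomial (MvPolynomial (Fin 3) K)) := Polynomial.prime_X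
  by_cases hQ1 : Polynomial.X ∣ scaleSubst K Q
  · obtain ⟨w, hw⟩ := hQ1
    rw [hw, pow_succ', mul_assoc] at h
    refine hX.pow_dvd_of_dvd_mul_left m (fun hd => hQ ?_)
      (mul_dvd_mul_iff_left hX.ne_zero |>.mp h)
    rw [hw, pow_two]
    exact mul_dvd_mul_left _ hd
  · exact (pow_dvd_pow _ (Nat.le_succ m)).trans (hX.pow_dvd_of_dvd_mul_left _ hQ1 h)

end Coordinates

section Secants

lemma IsSecant.map {R S E : Type*} [CommRing R] [CommRing S] [EquivLike E R S]
    [RingEquivClass E R S] (e : E) {p q : Ideal R} {Q L u v : R} (h : IsSecant p q Q L u v) :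
    IsSecant (p.map e) (q.map e) (e Q) (e L) (e u) (e v) := by
  have hmem : ∀ (I : Ideal R) x, e x ∈ I.map e ↔ x ∈ I := fun I x => by
    refine ⟨fun hx => ?_, Ideal.mem_map_of_mem e⟩
    obtain ⟨y, hy, hyx⟩ := (Ideal.mem_map_of_equiv e _).mp hx
    rwa [← EquivLike.injective e hyx]
  have hsing : ∀ a : R, Ideal.span {e a} = (Ideal.span {a}).map e := fun a => by
    rw [Ideal.map_span, Set.image_singleton]
  have hpair : ∀ a b : R, Ideal.span {e a, e b} = (Ideal.span {a, b}).map e := fun a b => by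
    rw [Ideal.map_span, Set.image_pair]
  have hp := h.left_prime
  have hq := h.right_prime
  refine ⟨by rw [hpair, ← h.left_eq], by rw [hpair, ← h.right_eq],
    Ideal.map_isPrime_of_equiv e, Ideal.map_isPrime_of_equiv e, by rw [hmem]; exact h.left_notMem,
    by rw [hmem]; exact h.right_notMem, by rw [hpair, ← map_mul, hmem]; exact h.mul_mem,
    fun F hF => ?_, fun F hF => ?_, fun m F hF => ?_⟩
  all_goals obtain ⟨F, rfl⟩ := EquivLike.surjective e F
  · rw [Ideal.mem_inf, hmem, hmem] at hF
    rw [hpair, hmem]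
    exact h.inf_le hF
  · rw [hsing, ← map_mul, hmem] at hF
    rw [hsing, hmem]
    exact h.regular F hF
  · rw [← Ideal.map_pow, ← map_mul, hmem] at hF
    rw [← Ideal.map_pow, hmem]
    exact h.cancel m F hF

variable {K : Type*} [Field K]

lemma homVanishingIdeal_single_two :
    homVanishingIdeal (Pi.single 2 1 : Fin 3 → K) = Ideal.span {X 0, X 1} := by
  ext F
  rw [mem_homVanishingIdeal_single_iff, ← Set.image_pair,
    show {i : Fin 3 | i ≠ 2} = {0, 1} by ext i; fin_cases i <;> simp]

lemma homVanishingIdeal_single_zero :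
    homVanishingIdeal (Pi.single 0 1 : Fin 3 → K) = Ideal.span {X 2, X 1} := by
  ext F
  rw [mem_homVanishingIdeal_single_iff, ← Set.image_pair,
    show {i : Fin 3 | i ≠ 0} = {2, 1} by ext i; fin_cases i <;> simp]

lemma support_of_mem_inf {F : MvPolynomial (Fin 3) K}
    (hF : F ∈ homVanishingIdeal (Pi.single 2 1 : Fin 3 → K) ⊓
      homVanishingIdeal (Pi.single 0 1 : Fin 3 → K)) {m : Fin 3 →₀ ℕ} (hm : m ∈ F.support) :
    m 1 ≠ 0 ∨ m 0 ≠ 0 ∧ m 2 ≠ 0 := by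
  obtain ⟨h2, h0⟩ := hF
  obtain ⟨i, hi, hmi⟩ := mem_ideal_span_X_image.mp
    ((mem_homVanishingIdeal_single_iff _ _).mp h2) m hm
  obtain ⟨j, hj, hmj⟩ := mem_ideal_span_X_image.mp
    ((mem_homVanishingIdeal_single_iff _ _).mp h0) m hm
  fin_cases i <;> fin_cases j <;> simp_all

lemma inf_le_span_X :
    homVanishingIdeal (Pi.single 2 1 : Fin 3 → K) ⊓ homVanishingIdeal (Pi.single 0 1 : Fin 3 → K)
      ≤ Ideal.span {X 1, X 0 * X 2} := by
  intro F hF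
  rw [← support_sum_monomial_coeff F]
  refine sum_mem fun m hm => ?_
  have h1 : (X 1 : MvPolynomial (Fin 3) K) ∈ Ideal.span {X 1, X 0 * X 2} :=
    Ideal.subset_span (by simp)
  have h2 : (X 0 * X 2 : MvPolynomial (Fin 3) K) ∈ Ideal.span {X 1, X 0 * X 2} :=
    Ideal.subset_span (by simp)
  rw [monomial_eq, Finsupp.prod_fintype _ _ (by simp), Fin.prod_univ_three]
  refine Ideal.mul_mem_left _ _ ?_
  rcases support_of_mem_inf hF hm with h | ⟨h0, h2'⟩
  · exact Ideal.mul_mem_right _ _ (Ideal.mul_mem_left _ _ (Ideal.pow_mem_of_mem _ h1 _ (by omega)))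
  · refine Ideal.mem_of_dvd _ ?_ h2
    rw [mul_right_comm]
    exact Dvd.dvd.mul_right (mul_dvd_mul (dvd_pow_self _ h0) (dvd_pow_self _ h2')) _

lemma eq_C_mul_add_of_mem_inf {Q : MvPolynomial (Fin 3) K} (hQ : Q.IsHomogeneous 2)
    (hmem : Q ∈ homVanishingIdeal (Pi.single 2 1 : Fin 3 → K) ⊓
      homVanishingIdeal (Pi.single 0 1 : Fin 3 → K)) :
    ∃ M : MvPolynomial (Fin 3) K, M.IsHomogeneous 1 ∧
      Q = C (coeff (Finsupp.single 0 1 + Finsupp.single 2 1) Q) * (X 0 * X 2) + X 1 * M := by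
  classical
  set d : Fin 3 →₀ ℕ := Finsupp.single 0 1 + Finsupp.single 2 1 with hd
  have hX : C (coeff d Q) * (X 0 * X 2) = monomial d (coeff d Q) := by
    rw [monomial_eq, Finsupp.prod_fintype _ _ (by simp), Fin.prod_univ_three]
    simp [hd]
  have hdvd : X 1 ∣ Q - monomial d (coeff d Q) := by
    have := mem_ideal_span_X_image (x := Q - monomial d (coeff d Q)) (s := {(1 : Fin 3)})
    rw [Set.image_singleton, Ideal.mem_span_singleton] at this
    refine this.mpr fun m hm => ⟨1, rfl, fun hm1 => ?_⟩
    rw [mem_support_iff, coeff_sub, coeff_monomial] at hm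
    split_ifs at hm with hdm
    · exact hm (by rw [hdm, sub_self])
    · rw [sub_zero] at hm
      have hdeg := hQ hm
      obtain h | ⟨h0, h2⟩ := support_of_mem_inf hmem (mem_support_iff.mpr hm)
      · exact h hm1
      · have hsum : m 0 + m 1 + m 2 = 2 := by
          simpa [Finsupp.weight_apply, Finsupp.sum_fintype, Fin.sum_univ_three] using hdeg
        refine hdm (Finsupp.ext fun i => ?_)
        fin_cases i <;> simp [hd] <;> omega
  obtain ⟨M, hM⟩ := hdvd
  refine ⟨M, fun m hm => ?_, by rw [hX, ← hM]; ring⟩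
  have hhom : (X 1 * M).IsHomogeneous 2 := by
    rw [← hM]
    exact hQ.sub (isHomogeneous_monomial _ (by simp [hd]))
  rw [← coeff_X_mul m (1 : Fin 3) M] at hm
  have := hhom hm
  simp only [map_add] at this
  simp [Finsupp.weight_apply] at this ⊢
  omega

lemma isSecant_single {Q : MvPolynomial (Fin 3) K} (hQ : Q.IsHomogeneous 2)
    (hmem : Q ∈ homVanishingIdeal (Pi.single 2 1 : Fin 3 → K) ⊓
      homVanishingIdeal (Pi.single 0 1 : Fin 3 → K))
    (hred : ∀ M : MvPolynomial (Fin 3) K, M.IsHomogeneous 1 → Q ≠ X 1 * M) :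
    IsSecant (homVanishingIdeal (Pi.single 2 1 : Fin 3 → K))
      (homVanishingIdeal (Pi.single 0 1 : Fin 3 → K)) Q (X 1) (X 2) (X 0) := by
  obtain ⟨M, hM, hQM⟩ := eq_C_mul_add_of_mem_inf hQ hmem
  set d : Fin 3 →₀ ℕ := Finsupp.single 0 1 + Finsupp.single 2 1 with hd
  set a := coeff d Q with ha
  have ha0 : a ≠ 0 := fun h => hred M hM (by simpa [h] using hQM)
  have hCa : (C a⁻¹ * C a : MvPolynomial (Fin 3) K) = 1 := by
    rw [← C_mul, inv_mul_cancel₀ ha0, C_1]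
  have hX : (X 0 * X 2 : MvPolynomial (Fin 3) K) ∈ Ideal.span {X 1, Q} :=
    Ideal.mem_span_pair.mpr ⟨-(C a⁻¹ * M), C a⁻¹, by
      linear_combination C a⁻¹ * hQM + X 0 * X 2 * hCa⟩
  refine ⟨homVanishingIdeal_single_two, homVanishingIdeal_single_zero, inferInstance,
    inferInstance, ?_, ?_, by rwa [mul_comm], ?_, fun F hF => ?_, fun m F hF => ?_⟩
  · rw [mem_homVanishingIdeal_iff_s7 (isHomogeneous_X K _)]; simp
  · rw [mem_homVanishingIdeal_iff_s7 (isHomogeneous_X K _)]; simp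
  · refine inf_le_span_X.trans (Ideal.span_le.mpr ?_)
    rintro x (rfl | rfl)
    · exact Ideal.subset_span (by simp)
    · exact hX
  · obtain ⟨G, hG⟩ := Ideal.mem_span_singleton'.mp hF
    have hprime : Prime (X 1 : MvPolynomial (Fin 3) K) := X_prime
    have hndvd : ¬ (X 1 : MvPolynomial (Fin 3) K) ∣ Q := fun ⟨N, hN⟩ => by
      have : (X 1 : MvPolynomial (Fin 3) K) ∣ X 0 * X 2 :=
        ⟨C a⁻¹ * (N - M), by linear_combination C a⁻¹ * hN - C a⁻¹ * hQM - X 0 * X 2 * hCa⟩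
      rcases hprime.dvd_or_dvd this with h | h <;> simp [X_dvd_X] at h
    obtain ⟨G', rfl⟩ := (hprime.dvd_or_dvd ⟨F, hG⟩).resolve_right hndvd
    refine Ideal.mem_span_singleton'.mpr ⟨G', mul_left_cancel₀ hprime.ne_zero ?_⟩
    rw [← hG, mul_assoc]
  · rw [homVanishingIdeal_single_two] at hF ⊢
    refine mem_span_pow_of_mul_mem (fun h => ha0 ?_) hF
    rw [mem_span_pow_iff_X_pow_dvd_scaleSubst, Polynomial.X_pow_dvd_iff] at h
    rw [ha, ← coeff_scaleSubst, h _ (by simp [hd]), coeff_zero]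

lemma exists_units_mulVec_single {p q : Fin 3 → K} (hp : p ≠ 0) (hpq : ∀ c : K, q ≠ c • p) :
    ∃ B : (Matrix (Fin 3) (Fin 3) K)ˣ, (B : Matrix (Fin 3) (Fin 3) K).mulVec (Pi.single 2 1) = p ∧
      (B : Matrix (Fin 3) (Fin 3) K).mulVec (Pi.single 0 1) = q := by
  suffices ∃ w : Fin 3 → K, (Matrix.of ![q, w, p]).transpose.det ≠ 0 by
    obtain ⟨w, hw⟩ := this
    refine ⟨((Matrix.isUnit_iff_isUnit_det _).mpr hw.isUnit).unit, ?_, ?_⟩ <;>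
    · ext i
      simp
  by_contra! h
  simp only [Matrix.det_transpose] at h
  have h0 := h (Pi.single 0 1)
  have h1 := h (Pi.single 1 1)
  have h2 := h (Pi.single 2 1)
  simp [Matrix.det_fin_three] at h0 h1 h2
  obtain ⟨c, hc⟩ := exists_eq_smul_of_mul_eq_mul hp (q := q) fun i j => by
    fin_cases i <;> fin_cases j <;> simp <;> grind
  exact hpq c hc

lemma exists_ne_zero_eval_eq_zero {M : MvPolynomial (Fin 3) K} (hM : M.IsHomogeneous 1) :
    ∃ y : Fin 3 → K, y ≠ 0 ∧ y 1 = 0 ∧ eval y M = 0 := by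
  have hlin : ∃ b : Fin 3 → K, ∀ y, eval y M = ∑ i, b i * y i := by
    rw [← mem_homogeneousSubmodule, homogeneousSubmodule_one_eq_span_X,
      Submodule.mem_span_range_iff_exists_fun] at hM
    obtain ⟨b, rfl⟩ := hM
    exact ⟨b, fun y => by simp [smul_eval]⟩
  obtain ⟨b, hb⟩ := hlin
  by_cases hb0 : b 0 = 0
  · exact ⟨Pi.single 0 1, by simp, by simp, by simp [hb, Fin.sum_univ_three, hb0]⟩
  · refine ⟨![b 2, 0, -b 0], fun h => hb0 ?_, rfl, ?_⟩
    · simpa using congrFun h 2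
    · simp [hb, Fin.sum_univ_three]
      ring

/-- Any two points on a smooth plane conic span a secant. -/
theorem exists_isSecant {Q : MvPolynomial (Fin 3) K} (hQ : Q.IsHomogeneous 2)
    (hsm : ∀ p : Fin 3 → K, p ≠ 0 → eval p Q = 0 → ∃ i, eval p (pderiv i Q) ≠ 0)
    {p q : Fin 3 → K} (hp : p ≠ 0) (hpq : ∀ c : K, q ≠ c • p) (hpQ : eval p Q = 0)
    (hqQ : eval q Q = 0) :
    ∃ L u v, IsSecant (homVanishingIdeal p) (homVanishingIdeal q) Q L u v := by
  obtain ⟨B, rfl, rfl⟩ := exists_units_mulVec_single hp hpq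
  have hQ' : (linearSubst (B : Matrix (Fin 3) (Fin 3) K) Q).IsHomogeneous 2 :=
    isHomogeneous_linearSubst _ hQ
  have h : IsSecant (homVanishingIdeal (Pi.single 2 1 : Fin 3 → K))
      (homVanishingIdeal (Pi.single 0 1 : Fin 3 → K))
      (linearSubst (B : Matrix (Fin 3) (Fin 3) K) Q) (X 1) (X 2) (X 0) := by
    refine isSecant_single hQ' ⟨?_, ?_⟩ fun M hM hQM => ?_
    · rwa [SetLike.mem_coe, mem_homVanishingIdeal_iff_s7 hQ', eval_linearSubst]
    · rwa [SetLike.mem_coe, mem_homVanishingIdeal_iff_s7 hQ', eval_linearSubst]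
    · obtain ⟨y, hy0, hy1, hyM⟩ := exists_ne_zero_eval_eq_zero hM
      set A : Matrix (Fin 3) (Fin 3) K := ↑B⁻¹ with hA
      have hQeq : Q = linearSubst A (X 1) * linearSubst A M := by
        rw [← map_mul, ← hQM]
        exact ((linearSubstEquiv B).symm_apply_apply Q).symm
      have hev : ∀ F, eval ((B : Matrix (Fin 3) (Fin 3) K).mulVec y) (linearSubst A F) = eval y F :=
        fun F => by
          rw [eval_linearSubst, Matrix.mulVec_mulVec, hA, Units.inv_mul, Matrix.one_mulVec]
      obtain ⟨i, hi⟩ := hsm ((B : Matrix (Fin 3) (Fin 3) K).mulVec y)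
        (fun h => hy0 (by
          have := congrArg A.mulVec h
          rwa [Matrix.mulVec_mulVec, hA, Units.inv_mul, Matrix.one_mulVec,
            Matrix.mulVec_zero] at this))
        (by rw [hQeq, map_mul, hev, hev, hyM, mul_zero])
      refine hi ?_
      rw [hQeq, pderiv_mul, map_add, map_mul, map_mul, hev, hev, hyM]
      simp [hy1]
  have h' := h.map (linearSubstEquiv B).symm
  rw [map_linearSubstEquiv_symm, map_linearSubstEquiv_symm] at h'
  have hQs : (linearSubstEquiv B).symm (linearSubst (B : Matrix (Fin 3) (Fin 3) K) Q) = Q :=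
    (linearSubstEquiv B).symm_apply_apply Q
  rw [hQs] at h'
  exact ⟨_, _, _, h'⟩

end Secants

/-- For the radical ideal of an odd number `n ≥ 5` of distinct points on a
smooth plane conic, `I^{(2r+1)} = (I^{(2)})^r · I` for every `r ≥ 0`. -/
theorem stmt7 {K : Type*} [Field K] [IsAlgClosed K]
    {n : ℕ} (hn : 5 ≤ n) (hodd : Odd n)
    (Q : MvPolynomial (Fin 3) K) (hQdeg : Q.IsHomogeneous 2) (hQ0 : Q ≠ 0)
    (hsm : ∀ p : Fin 3 → K, p ≠ 0 → MvPolynomial.eval p Q = 0 →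
      ∃ i, MvPolynomial.eval p (MvPolynomial.pderiv i Q) ≠ 0)
    (P : Fin n → (Fin 3 → K)) (hP : ProjectivelyDistinct P)
    (honC : ∀ i, MvPolynomial.eval (P i) Q = 0)
    (r : ℕ) :
    symbPow P (2 * r + 1) = symbPow P 2 ^ r * symbPow P 1 := by
  obtain ⟨m, rfl⟩ : ∃ m, n = m + 2 := ⟨n - 2, by omega⟩
  have hσ : ∀ i : Fin (m + 2), Equiv.addRight 1 i ≠ i := by simp
  choose L u v h using fun i => exists_isSecant hQdeg hsm (hP.1 i) (hP.2 (hσ i)) (honC i)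
    (honC (Equiv.addRight 1 i))
  refine iInf_pow_odd_eq h hσ (fun i => (mem_homVanishingIdeal_iff_s7 hQdeg).mpr (honC i))
    (fun i j hij => ?_) r
  by_contra hne
  obtain ⟨c, hc⟩ := exists_eq_smul_of_mul_eq_mul (hP.1 i) (mul_eq_mul_of_homVanishingIdeal_le hij)
  exact hP.2 (Ne.symm hne) c hc
end
end
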